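/- Let N ≥ 1 and let a ribbon graph with n ≥ 1 edges and a single vertex be given, i.e. σ is a permutation of H = {±1,…,±n} consisting of a single 2n-cycle, with corner matrices C_i ∈ M_N(ℂ), and let λ be a partition with at most N parts. Then the integral of s_λ(𝔙(X)) over (X_1,…,X_n) ∈ SU(N)^n with respect to the product Haar probability measure equals the integral of s_λ(𝔙(X)) over (X_1,…,X_n) ∈ U(N)^n with respect to the product Haar probability measure, and both equal s_λ(I_N)^{−n} · ∏_{f ∈ cycles(φ)} s_λ(𝔙*_f), where 𝔙(X) is the dressed monodromy of the unique vertex and φ = τ∘σ is the face permutation. -/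

import Mathlib

open scoped BigOperators Classical
open MeasureTheory Matrix

noncomputable section

/-- Complete homogeneous symmetric functions of the eigenvalues of `X`, defined through
Newton's identities from the power sums `p_m = Tr(X^m)`. -/
def hMat {N : ℕ} (X : Matrix (Fin N) (Fin N) ℂ) : ℕ → ℂ
  | 0 => 1
  | (k+1) => ((k : ℂ) + 1)⁻¹ *
      ∑ m ∈ Finset.range (k+1), (X ^ (m+1)).trace * hMat X (k - m)
  termination_by k => k
  decreasing_by exact Nat.lt_succ_of_le (Nat.sub_le _ _)

def hMatZ {N : ℕ} (X : Matrix (Fin N) (Fin N) ℂ) (k : ℤ) : ℂ :=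
  if k < 0 then 0 else hMat X k.toNat

/-- The Schur polynomial `s_λ(X)` of an `N×N` complex matrix `X`, evaluated at the
eigenvalues of `X`, via the Jacobi-Trudi formula `s_λ = det(h_{λ_i - i + j})`.
Here `l : Fin N → ℕ` lists the (at most `N`) parts of the partition `λ`. -/
def schur {N : ℕ} (l : Fin N → ℕ) (X : Matrix (Fin N) (Fin N) ℂ) : ℂ :=
  (Matrix.of fun i j : Fin N => hMatZ X ((l i : ℤ) - (i : ℤ) + (j : ℤ))).det

/-- Partitions with at most `N` parts (weakly decreasing functions `Fin N → ℕ`). -/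
def PartitionN (N : ℕ) := {l : Fin N → ℕ // Antitone l}

/-- The unitary group `U(N)`. -/
abbrev UN (N : ℕ) := Matrix.unitaryGroup (Fin N) ℂ

instance (N : ℕ) : MeasurableSpace (UN N) := borel _

/-- The special unitary group `SU(N)`, as a subgroup of `U(N)`. -/
def SUN (N : ℕ) : Subgroup (UN N) where
  carrier := {U | (U : Matrix (Fin N) (Fin N) ℂ).det = 1}
  one_mem' := by simp
  mul_mem' := by
    intro a b ha hb
    simp only [Set.mem_setOf_eq, Submonoid.coe_mul, Matrix.det_mul] at *
    rw [ha, hb, mul_one]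
  inv_mem' := by
    intro a ha
    simp only [Set.mem_setOf_eq] at *
    have h1 : ((a⁻¹ : UN N) : Matrix (Fin N) (Fin N) ℂ)
        = star (a : Matrix (Fin N) (Fin N) ℂ) := rfl
    have h2 : (star (a : Matrix (Fin N) (Fin N) ℂ)).det
        = star ((a : Matrix (Fin N) (Fin N) ℂ)).det := by
      simp [Matrix.star_eq_conjTranspose, Matrix.det_conjTranspose]
    rw [h1, h2, ha, star_one]

instance (N : ℕ) : MeasurableSpace (SUN N) := borel _

/-- The product of the values of `F` along the cycle of the permutation `σ` through `x`:
`F x * F (σ x) * ⋯ * F (σ^{k-1} x)`, `k` being the length of that cycle. -/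
def cycleProd {α R : Type*} [Monoid R] (σ : Equiv.Perm α) (F : α → R) (x : α) : R :=
  ((List.range (Function.minimalPeriod σ x)).map fun t => F ((σ ^ t) x)).prod

/-- The involution `τ : i ↦ -i` on the set `H = {±1,…,±n}` of sides of the ribbon edges;
a side is encoded as a pair in `Fin n × Bool`, `(i, true)` standing for the side `+i`
and `(i, false)` for the side `-i`. -/
def tauPerm (n : ℕ) : Equiv.Perm (Fin n × Bool) :=
  Equiv.prodCongr (Equiv.refl (Fin n)) ⟨not, not, Bool.not_not, Bool.not_not⟩

/-- The dressing `C_i ↦ X_i C_i` of the corner matrices, where `X_{-i} = X_i†`. -/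
def dress {N n : ℕ} (C : Fin n × Bool → Matrix (Fin N) (Fin N) ℂ)
    (X : Fin n → Matrix (Fin N) (Fin N) ℂ) : Fin n × Bool → Matrix (Fin N) (Fin N) ℂ :=
  fun s => (if s.2 then X s.1 else (X s.1)ᴴ) * C s

/-! ### Counting functions of tuples -/

/-- The number of occurrences of each letter in a word `z`. -/
def letterCount {ι : Type*} {k : ℕ} (z : Fin k → ι) (i : ι) : ℕ :=
  Nat.card {t // z t = i}

lemma letterCount_comp_perm {ι : Type*} {k : ℕ} (z : Fin k → ι) (π : Equiv.Perm (Fin k)) :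
    letterCount (z ∘ π) = letterCount z := by
  funext i
  exact Nat.card_congr (π.subtypeEquiv fun t => Iff.rfl)

lemma exists_perm_of_letterCount_eq {ι : Type*} {k : ℕ} {z w : Fin k → ι}
    (h : letterCount z = letterCount w) : ∃ π : Equiv.Perm (Fin k), w = z ∘ π := by
  have e : ∀ i, {t // w t = i} ≃ {t // z t = i} := fun i =>
    (Finite.card_eq.mp (congrFun h i).symm).some
  exact ⟨Equiv.ofFiberEquiv e, funext fun t => (Equiv.ofFiberEquiv_map e t).symm⟩

lemma prod_comp_eq_prod_pow_letterCount {ι R : Type*} [Fintype ι] [CommMonoid R] {k : ℕ}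
    (z : Fin k → ι) (f : ι → R) : ∏ t, f (z t) = ∏ i, f i ^ letterCount z i := by
  rw [← Finset.prod_fiberwise_of_maps_to (fun t _ => Finset.mem_univ (z t))]
  refine Finset.prod_congr rfl fun i _ => ?_
  rw [Finset.prod_congr rfl (g := fun _ => f i), Finset.prod_const]
  · simp [letterCount, Fintype.card_subtype]
  · intro t ht
    rw [(Finset.mem_filter.mp ht).2]

lemma sum_letterCount {ι : Type*} [Fintype ι] {k : ℕ} (z : Fin k → ι) :
    ∑ i, letterCount z i = k := by
  simp only [letterCount]
  rw [← Nat.card_sigma, Nat.card_congr (Equiv.sigmaFiberEquiv z), Nat.card_fin]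

lemma exists_letterCount_eq {ι : Type*} [Fintype ι] {k : ℕ} {m : ι → ℕ} (hm : ∑ i, m i = k) :
    ∃ z : Fin k → ι, letterCount z = m := by
  have hc : Fintype.card (Fin k) = Fintype.card (Σ i, Fin (m i)) := by simp [hm]
  let e := Fintype.equivOfCardEq hc
  refine ⟨fun t => (e t).1, funext fun i => ?_⟩
  rw [letterCount, Nat.card_congr (e.subtypeEquiv (q := fun x => x.1 = i) fun _ => Iff.rfl),
    Nat.card_congr (Equiv.sigmaSubtype i), Nat.card_fin]

lemma letterCount_fst {N k : ℕ} (z : Fin k → Fin N × Fin N) (i : Fin N) :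
    letterCount (fun t => (z t).1) i = ∑ j, letterCount z (i, j) := by
  simp only [letterCount]
  rw [← Nat.card_sigma]
  refine Nat.card_congr ⟨fun t => ⟨(z t).2, ⟨t, Prod.ext t.2 rfl⟩⟩,
    fun x => ⟨x.2, congrArg Prod.fst x.2.2⟩, fun _ => rfl, ?_⟩
  rintro ⟨j, t, ht⟩
  obtain rfl : (z t).2 = j := congrArg Prod.snd ht
  rfl

/-! ### The algebra of symmetric tensors -/

/-- The `k`-th tensor power of a matrix. -/
def tensorPow {N : ℕ} (k : ℕ) (A : Matrix (Fin N) (Fin N) ℂ) :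
    Matrix (Fin k → Fin N) (Fin k → Fin N) ℂ :=
  Matrix.of fun a b => ∏ t, A (a t) (b t)

lemma tensorPow_mul {N k : ℕ} (A B : Matrix (Fin N) (Fin N) ℂ) :
    tensorPow k (A * B) = tensorPow k A * tensorPow k B := by
  ext a b
  simp only [tensorPow, Matrix.of_apply, Matrix.mul_apply, ← Finset.prod_mul_distrib]
  exact (Finset.prod_univ_sum (fun _ => Finset.univ) _).trans (by simp)

lemma tensorPow_one {N k : ℕ} : tensorPow k (1 : Matrix (Fin N) (Fin N) ℂ) = 1 := by
  ext a b
  simp only [tensorPow, Matrix.of_apply, Matrix.one_apply, Finset.prod_ite_zero,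
    Finset.prod_const_one, funext_iff, Finset.mem_univ, true_imp_iff]

lemma tensorPow_smul {N k : ℕ} (z : ℂ) (A : Matrix (Fin N) (Fin N) ℂ) :
    tensorPow k (z • A) = z ^ k • tensorPow k A := by
  ext a b
  simp [tensorPow, Finset.prod_mul_distrib]

/-- The matrices on `(ℂ^N)^{⊗ k}` that commute with all permutations of the tensor factors. -/
def symTensor (N k : ℕ) : Subalgebra ℂ (Matrix (Fin k → Fin N) (Fin k → Fin N) ℂ) where
  carrier := {M | ∀ (π : Equiv.Perm (Fin k)) a b, M (a ∘ π) (b ∘ π) = M a b}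
  mul_mem' := by
    intro M M' hM hM' π a b
    simp only [Matrix.mul_apply]
    rw [← (Equiv.arrowCongr π.symm (Equiv.refl (Fin N))).sum_comp]
    refine Finset.sum_congr rfl fun c _ => ?_
    have : Equiv.arrowCongr π.symm (Equiv.refl (Fin N)) c = c ∘ π := by
      funext t; simp
    rw [this, hM, hM']
  add_mem' := by
    intro M M' hM hM' π a b
    simp [hM π a b, hM' π a b]
  algebraMap_mem' := by
    intro r π a b
    simp [Matrix.algebraMap_matrix_apply, π.surjective.injective_comp_right.eq_iff]

lemma tensorPow_mem {N k : ℕ} (A : Matrix (Fin N) (Fin N) ℂ) :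
    tensorPow k A ∈ symTensor N k := fun π a b =>
  Equiv.prod_comp π fun t => A (a t) (b t)

lemma diagonal_mem_symTensor {N k : ℕ} {f : (Fin k → Fin N) → ℂ}
    (hf : ∀ (π : Equiv.Perm (Fin k)) a, f (a ∘ π) = f a) :
    Matrix.diagonal f ∈ symTensor N k := by
  intro π a b
  simp [Matrix.diagonal_apply, π.surjective.injective_comp_right.eq_iff, hf]

lemma conjTranspose_mem_symTensor {N k : ℕ} {M : Matrix (Fin k → Fin N) (Fin k → Fin N) ℂ}
    (hM : M ∈ symTensor N k) : Mᴴ ∈ symTensor N k := by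
  intro π a b
  simp [Matrix.conjTranspose_apply, hM π b a]

lemma apply_eq_of_mem_symTensor {N k : ℕ} {M : Matrix (Fin k → Fin N) (Fin k → Fin N) ℂ}
    (hM : M ∈ symTensor N k) {z w : Fin k → Fin N × Fin N} (h : letterCount z = letterCount w) :
    M (fun t => (z t).1) (fun t => (z t).2) = M (fun t => (w t).1) (fun t => (w t).2) := by
  obtain ⟨π, rfl⟩ := exists_perm_of_letterCount_eq h
  exact (hM π _ _).symm

open scoped ComplexOrder in
lemma Matrix.IsHermitian.eq_zero_of_isNilpotent {m : Type*} [Fintype m] [DecidableEq m]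
    {A : Matrix m m ℂ} (hA : A.IsHermitian) (hn : IsNilpotent A) : A = 0 := by
  obtain ⟨n, hn⟩ := hn
  have key : ∀ j, A ^ 2 ^ j = 0 → A = 0 := by
    intro j
    induction j with
    | zero => simp
    | succ j ih =>
      intro h
      apply ih
      rw [← Matrix.conjTranspose_mul_self_eq_zero, Matrix.conjTranspose_pow, hA.eq, ← pow_add,
        ← h]
      congr 1
      ring
  exact key n (pow_eq_zero_of_le Nat.lt_two_pow_self.le hn)

lemma Subalgebra.isSemisimpleRing_of_conjTranspose_mem {m : Type*} [Fintype m] [DecidableEq m]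
    (S : Subalgebra ℂ (Matrix m m ℂ)) (hS : ∀ M ∈ S, Mᴴ ∈ S) : IsSemisimpleRing S := by
  have : IsArtinianRing S := IsArtinianRing.of_finite ℂ S
  rw [IsArtinianRing.isSemisimpleRing_iff_jacobson, eq_bot_iff]
  intro x hx
  have hnil : IsNilpotent ((⟨_, hS _ x.2⟩ : S) * x) := by
    obtain ⟨n, hn⟩ := IsSemiprimaryRing.isNilpotent (R := S)
    refine ⟨n, ?_⟩
    have := Ideal.pow_mem_pow (Ideal.mul_mem_left _ (⟨_, hS _ x.2⟩ : S) hx) n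
    rw [hn] at this
    simpa using this
  have h0 : (x : Matrix m m ℂ)ᴴ * x = 0 :=
    (Matrix.isHermitian_conjTranspose_mul_self _).eq_zero_of_isNilpotent (hnil.map S.val)
  open scoped ComplexOrder in
  exact Subtype.ext (Matrix.conjTranspose_mul_self_eq_zero.mp h0)

/-- A word with given letter counts. -/
def wordOf {ι : Type*} [Fintype ι] {k : ℕ}
    (m : {m : ι → ℕ // ∑ i, m i = k}) : Fin k → ι :=
  (exists_letterCount_eq m.2).choose

lemma letterCount_wordOf {ι : Type*} [Fintype ι] {k : ℕ}
    (m : {m : ι → ℕ // ∑ i, m i = k}) : letterCount (wordOf m) = m :=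
  (exists_letterCount_eq m.2).choose_spec

instance {ι : Type*} [Fintype ι] (k : ℕ) : Fintype {m : ι → ℕ // ∑ i, m i = k} :=
  Fintype.subtype (Finset.piAntidiag Finset.univ k) fun m => by simp [Finset.mem_piAntidiag]

/-- Symmetric tensors are the functions of the joint letter count of the row and the column. -/
def symTensorEquiv (N k : ℕ) :
    symTensor N k ≃ₗ[ℂ]
      ({m : Fin N × Fin N → ℕ // ∑ p, m p = k} → ℂ) where
  toFun M m := (M : Matrix _ _ ℂ) (fun t => (wordOf m t).1) (fun t => (wordOf m t).2)
  map_add' _ _ := rfl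
  map_smul' _ _ := rfl
  invFun g := ⟨Matrix.of fun a b => g ⟨_, sum_letterCount fun t => (a t, b t)⟩, fun π a b =>
    congrArg g (Subtype.ext (letterCount_comp_perm (fun t => (a t, b t)) π))⟩
  left_inv M := Subtype.ext <| Matrix.ext fun a b =>
    apply_eq_of_mem_symTensor (w := fun t => (a t, b t)) M.2 (letterCount_wordOf _)
  right_inv g := funext fun m => congrArg g (Subtype.ext (letterCount_wordOf m))

lemma symTensorEquiv_symm_apply {N k : ℕ}
    (g : {m : Fin N × Fin N → ℕ // ∑ p, m p = k} → ℂ)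
    (a b : Fin k → Fin N) :
    ((symTensorEquiv N k).symm g : Matrix _ _ ℂ) a b =
      g ⟨_, sum_letterCount fun t => (a t, b t)⟩ := rfl

/-- The trace on symmetric tensors of `M ↦ P * M * Q` for `P` and `Q` diagonal. -/
lemma trace_diagonal_mul_mul_diagonal {N k : ℕ} {f g : (Fin k → Fin N) → ℂ}
    (P Q : symTensor N k) (hP : (P : Matrix _ _ ℂ) = Matrix.diagonal f)
    (hQ : (Q : Matrix _ _ ℂ) = Matrix.diagonal g) :
    LinearMap.trace ℂ (symTensor N k) (LinearMap.mulLeftRight ℂ (P, Q)) =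
      ∑ m : {m : Fin N × Fin N → ℕ // ∑ p, m p = k},
        f (fun t => (wordOf m t).1) * g (fun t => (wordOf m t).2) := by
  rw [← LinearMap.trace_conj' _ (symTensorEquiv N k),
    LinearMap.trace_eq_matrix_trace ℂ (Pi.basisFun ℂ _), Matrix.trace]
  refine Finset.sum_congr rfl fun m _ => ?_
  rw [Matrix.diag_apply, LinearMap.toMatrix_apply, Pi.basisFun_repr, Pi.basisFun_apply,
    LinearEquiv.conj_apply_apply, LinearMap.mulLeftRight_apply]
  change ((P : Matrix (Fin k → Fin N) (Fin k → Fin N) ℂ) *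
    ((symTensorEquiv N k).symm (Pi.single m 1) : Matrix (Fin k → Fin N) (Fin k → Fin N) ℂ) *
    (Q : Matrix (Fin k → Fin N) (Fin k → Fin N) ℂ)) _ _ = _
  rw [hP, hQ, Matrix.mul_diagonal, Matrix.diagonal_mul, symTensorEquiv_symm_apply]
  have : (⟨_, sum_letterCount fun t => ((wordOf m t).1, (wordOf m t).2)⟩ :
    {m : Fin N × Fin N → ℕ // ∑ p, m p = k}) = m :=
    Subtype.ext (letterCount_wordOf m)
  rw [this, Pi.single_eq_same, mul_one]
/-! ### Polynomial functions on matrices -/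

/-- A function on matrices whose restriction to every affine line is polynomial. -/
def LinePoly {N : ℕ} (f : Matrix (Fin N) (Fin N) ℂ → ℂ) : Prop :=
  ∀ A B, ∃ q : Polynomial ℂ, ∀ t : ℂ, f (A + t • B) = q.eval t

namespace LinePoly

variable {N : ℕ}

lemma const (c : ℂ) : LinePoly fun _ : Matrix (Fin N) (Fin N) ℂ => c :=
  fun _ _ => ⟨Polynomial.C c, fun _ => by simp⟩

lemma apply (i j : Fin N) : LinePoly fun A : Matrix (Fin N) (Fin N) ℂ => A i j :=
  fun A B => ⟨Polynomial.C (A i j) + Polynomial.X * Polynomial.C (B i j),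
    fun t => by simp [mul_comm t]⟩

lemma add {f g : Matrix (Fin N) (Fin N) ℂ → ℂ} (hf : LinePoly f) (hg : LinePoly g) :
    LinePoly fun A => f A + g A := fun A B => by
  obtain ⟨p, hp⟩ := hf A B
  obtain ⟨q, hq⟩ := hg A B
  exact ⟨p + q, fun t => by simp [hp, hq]⟩

lemma mul {f g : Matrix (Fin N) (Fin N) ℂ → ℂ} (hf : LinePoly f) (hg : LinePoly g) :
    LinePoly fun A => f A * g A := fun A B => by
  obtain ⟨p, hp⟩ := hf A B
  obtain ⟨q, hq⟩ := hg A B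
  exact ⟨p * q, fun t => by simp [hp, hq]⟩

lemma sum {ι : Type*} {s : Finset ι} {f : ι → Matrix (Fin N) (Fin N) ℂ → ℂ}
    (hf : ∀ i ∈ s, LinePoly (f i)) : LinePoly fun A => ∑ i ∈ s, f i A := by
  induction s using Finset.induction_on with
  | empty => simpa using const 0
  | insert i s hi ih =>
    simp only [Finset.sum_insert hi]
    exact (hf i (by simp)).add (ih fun j hj => hf j (by simp [hj]))

lemma prod {ι : Type*} {s : Finset ι} {f : ι → Matrix (Fin N) (Fin N) ℂ → ℂ}
    (hf : ∀ i ∈ s, LinePoly (f i)) : LinePoly fun A => ∏ i ∈ s, f i A := by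
  induction s using Finset.induction_on with
  | empty => simpa using const 1
  | insert i s hi ih =>
    simp only [Finset.prod_insert hi]
    exact (hf i (by simp)).mul (ih fun j hj => hf j (by simp [hj]))

lemma det {m : Type*} [Fintype m] [DecidableEq m]
    {F : Matrix (Fin N) (Fin N) ℂ → Matrix m m ℂ}
    (hF : ∀ i j, LinePoly fun A => F A i j) : LinePoly fun A => (F A).det := by
  simp only [Matrix.det_apply']
  exact sum fun σ _ => (const _).mul (prod fun i _ => hF _ _)

lemma matrix_mul {m : Type*} [Fintype m] {F G : Matrix (Fin N) (Fin N) ℂ → Matrix m m ℂ}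
    (hF : ∀ i j, LinePoly fun A => F A i j) (hG : ∀ i j, LinePoly fun A => G A i j) (i j : m) :
    LinePoly fun A => (F A * G A) i j := by
  simp only [Matrix.mul_apply]
  exact sum fun l _ => (hF _ _).mul (hG _ _)

lemma adjugate {m : Type*} [Fintype m] [DecidableEq m]
    {F : Matrix (Fin N) (Fin N) ℂ → Matrix m m ℂ}
    (hF : ∀ i j, LinePoly fun A => F A i j) (i j : m) :
    LinePoly fun A => (F A).adjugate i j := by
  simp only [Matrix.adjugate_apply]
  refine det fun a b => ?_
  by_cases h : a = j
  · simpa [Matrix.updateRow_apply, h] using const _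
  · simpa [Matrix.updateRow_apply, h] using hF a b

lemma linear_tensorPow {k : ℕ} (ℓ : Matrix (Fin k → Fin N) (Fin k → Fin N) ℂ →ₗ[ℂ] ℂ)
    {F : Matrix (Fin N) (Fin N) ℂ → Matrix (Fin N) (Fin N) ℂ}
    (hF : ∀ i j, LinePoly fun A => F A i j) : LinePoly fun A => ℓ (tensorPow k (F A)) := by
  have h : ∀ A, ℓ (tensorPow k (F A)) =
      ∑ a, ∑ b, (∏ t, F A (a t) (b t)) * ℓ (Matrix.single a b 1) := by
    intro A
    conv_lhs => rw [Matrix.matrix_eq_sum_single (tensorPow k (F A))]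
    simp only [map_sum]
    refine Finset.sum_congr rfl fun a _ => Finset.sum_congr rfl fun b _ => ?_
    rw [← smul_eq_mul, ← map_smul, Matrix.smul_single, smul_eq_mul, mul_one]
    rfl
  simp only [h]
  exact sum fun a _ => sum fun b _ => (prod fun t _ => hF _ _).mul (const _)

/-- Hermitian matrices are Zariski dense. -/
lemma eq_zero_of_isHermitian {f : Matrix (Fin N) (Fin N) ℂ → ℂ} (hf : LinePoly f)
    (h : ∀ H, H.IsHermitian → f H = 0) (A : Matrix (Fin N) (Fin N) ℂ) : f A = 0 := by
  set B : Matrix (Fin N) (Fin N) ℂ := (2⁻¹ : ℂ) • (A + Aᴴ) with hB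
  set D : Matrix (Fin N) (Fin N) ℂ := (-Complex.I * 2⁻¹) • (A - Aᴴ) with hD
  obtain ⟨q, hq⟩ := hf B D
  have hBH : Bᴴ = B := by
    simp [hB, Matrix.conjTranspose_smul, add_comm]
  have hDH : Dᴴ = D := by
    simp only [hD, Matrix.conjTranspose_smul, Matrix.conjTranspose_sub,
      Matrix.conjTranspose_conjTranspose]
    rw [← neg_sub A Aᴴ, smul_neg, ← neg_smul]
    congr 1
    simp
  have hreal : ∀ t : ℝ, q.eval (t : ℂ) = 0 := fun t => by
    rw [← hq]
    apply h
    rw [Matrix.IsHermitian, Matrix.conjTranspose_add, hBH, Matrix.conjTranspose_smul, hDH]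
    simp
  have hq0 : q = 0 := Polynomial.eq_zero_of_infinite_isRoot q <|
    (Set.infinite_range_of_injective Complex.ofReal_injective).mono <| by
      rintro _ ⟨t, rfl⟩
      exact hreal t
  have hA : A = B + Complex.I • D := by
    have h2 : Complex.I * (-Complex.I * 2⁻¹) = (2⁻¹ : ℂ) := by
      rw [← mul_assoc]
      simp
    rw [hB, hD, smul_smul, h2, ← smul_add, add_add_sub_cancel, ← two_smul ℂ A, smul_smul]
    simp
  rw [hA, hq, hq0, Polynomial.eval_zero]

end LinePoly

open scoped ComplexOrder in
lemma det_one_sub_I_smul_ne_zero {N : ℕ} {H : Matrix (Fin N) (Fin N) ℂ} (hH : H.IsHermitian) :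
    (1 - Complex.I • H).det ≠ 0 := by
  have h : ((1 + Complex.I • H) * (1 - Complex.I • H)).det ≠ 0 := by
    have e : (1 + Complex.I • H) * (1 - Complex.I • H) = 1 + Hᴴ * H := by
      rw [hH.eq]
      simp [mul_sub, add_mul, smul_smul]
      abel
    rw [e]
    exact (Matrix.PosDef.one.add_posSemidef
      (Matrix.posSemidef_conjTranspose_mul_self H)).det_pos.ne'
  rw [Matrix.det_mul] at h
  exact right_ne_zero_of_mul h

lemma cayley_mem_unitaryGroup {N : ℕ} {H : Matrix (Fin N) (Fin N) ℂ} (hH : H.IsHermitian) :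
    (1 + Complex.I • H) * (1 - Complex.I • H)⁻¹ ∈ Matrix.unitaryGroup (Fin N) ℂ := by
  have hu : IsUnit (1 - Complex.I • H).det := (det_one_sub_I_smul_ne_zero hH).isUnit
  have hs : (1 - Complex.I • H)ᴴ = 1 + Complex.I • H := by
    simp [Matrix.conjTranspose_smul, hH.eq]
  have hs' : (1 + Complex.I • H)ᴴ = 1 - Complex.I • H := by
    rw [← hs, Matrix.conjTranspose_conjTranspose]
  have hu' : IsUnit (1 + Complex.I • H).det := by
    rw [← hs, Matrix.det_conjTranspose]
    exact hu.star
  have hc : (1 + Complex.I • H) * (1 - Complex.I • H) =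
      (1 - Complex.I • H) * (1 + Complex.I • H) := by
    simp only [mul_sub, add_mul, sub_mul, mul_add, mul_one, one_mul]
    abel
  rw [Matrix.mem_unitaryGroup_iff', Matrix.star_eq_conjTranspose, Matrix.conjTranspose_mul,
    Matrix.conjTranspose_nonsing_inv, hs, hs', mul_assoc, ← mul_assoc (1 - Complex.I • H), ← hc,
    mul_assoc (1 + Complex.I • H), Matrix.mul_nonsing_inv _ hu, mul_one,
    Matrix.nonsing_inv_mul _ hu']

lemma exists_det_one_add_smul_ne_zero {N : ℕ} (A : Matrix (Fin N) (Fin N) ℂ) :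
    ∃ ε : ℂ, ε ≠ 0 ∧ (1 + ε • A).det ≠ 0 := by
  obtain ⟨q, hq⟩ := (LinePoly.det (F := id) LinePoly.apply) 1 A
  by_contra! h
  have h0 : Polynomial.X * q = 0 := Polynomial.funext fun t => by
    by_cases ht : t = 0
    · simp [ht]
    · simp [← hq, h t ht]
  rcases mul_eq_zero.mp h0 with h1 | h1
  · exact Polynomial.X_ne_zero h1
  · have := hq 0
    simp [h1] at this

/-- Unitary matrices are Zariski dense. -/
lemma linear_tensorPow_eq_zero_of_unitary {N k : ℕ}
    (ℓ : Matrix (Fin k → Fin N) (Fin k → Fin N) ℂ →ₗ[ℂ] ℂ)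
    (h : ∀ U ∈ Matrix.unitaryGroup (Fin N) ℂ, ℓ (tensorPow k U) = 0)
    (A : Matrix (Fin N) (Fin N) ℂ) : ℓ (tensorPow k A) = 0 := by
  have hlin : ∀ c : ℂ, ∀ i j, LinePoly fun Z : Matrix (Fin N) (Fin N) ℂ => (1 + c • Z) i j :=
    fun c i j => by
      simpa using (LinePoly.const _).add ((LinePoly.const c).mul (LinePoly.apply i j))
  have hsub : ∀ Z : Matrix (Fin N) (Fin N) ℂ, 1 + (-Complex.I) • Z = 1 - Complex.I • Z :=
    fun Z => by rw [neg_smul, sub_eq_add_neg]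
  have hall : ∀ Z : Matrix (Fin N) (Fin N) ℂ,
      ℓ (tensorPow k ((1 + Complex.I • Z) * (1 + (-Complex.I) • Z).adjugate)) = 0 := by
    refine LinePoly.eq_zero_of_isHermitian (LinePoly.linear_tensorPow ℓ
      (LinePoly.matrix_mul (hlin _) (LinePoly.adjugate (hlin _)))) fun H hH => ?_
    have hd := det_one_sub_I_smul_ne_zero hH
    have e : (1 - Complex.I • H).adjugate =
        (1 - Complex.I • H).det • (1 - Complex.I • H)⁻¹ := by
      rw [Matrix.inv_def, smul_smul, Ring.mul_inverse_cancel _ hd.isUnit, one_smul]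
    rw [hsub, e, Matrix.mul_smul, tensorPow_smul, map_smul, h _ (cayley_mem_unitaryGroup hH),
      smul_zero]
  obtain ⟨ε, hε, hdet⟩ := exists_det_one_add_smul_ne_zero A
  set W := (1 + ε • A)⁻¹ with hW
  have hAW : (1 + ε • A) * W = 1 := Matrix.mul_nonsing_inv _ hdet.isUnit
  have h1 : 1 + Complex.I • (-Complex.I • ((ε • A - 1) * W)) = (2 * ε) • (A * W) := by
    nth_rw 1 [smul_smul, ← hAW]
    simp [add_mul, sub_mul, two_mul, add_smul]
    abel
  have h2 : 1 + (-Complex.I) • (-Complex.I • ((ε • A - 1) * W)) = (2 : ℂ) • W := by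
    nth_rw 1 [smul_smul, ← hAW]
    simp [add_mul, sub_mul, two_smul]
  have hz := hall (-Complex.I • ((ε • A - 1) * W))
  have h3 : (2 * ε) • (A * W) * ((2 : ℂ) • W).adjugate = (ε * ((2 : ℂ) • W).det) • A := by
    have : (2 * ε) • (A * W) = ε • (A * ((2 : ℂ) • W)) := by
      rw [Matrix.mul_smul, smul_smul, mul_comm]
    rw [this, Matrix.smul_mul, mul_assoc, Matrix.mul_adjugate, Matrix.mul_smul, mul_one, smul_smul]
  rw [h1, h2, h3, tensorPow_smul, map_smul, smul_eq_zero] at hz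
  refine hz.resolve_left (pow_ne_zero _ (mul_ne_zero hε ?_))
  rw [Matrix.det_smul]
  refine mul_ne_zero (pow_ne_zero _ two_ne_zero) ?_
  have := congrArg Matrix.det hAW
  rw [Matrix.det_mul, Matrix.det_one] at this
  exact right_ne_zero_of_mul (this ▸ one_ne_zero)

/-- Tensor powers of unitary matrices span the symmetric tensors. -/
lemma mem_span_tensorPow_unitary {N k : ℕ} {M : Matrix (Fin k → Fin N) (Fin k → Fin N) ℂ}
    (hM : M ∈ symTensor N k) :
    M ∈ Submodule.span ℂ (Set.range fun U : UN N => tensorPow k (U : Matrix (Fin N) (Fin N) ℂ)) := by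
  by_contra hMn
  obtain ⟨ℓ, hℓ, hker⟩ := Submodule.exists_dual_map_eq_bot_of_notMem hMn inferInstance
  have hzero : ∀ A, ℓ (tensorPow k A) = 0 := by
    refine linear_tensorPow_eq_zero_of_unitary ℓ fun U hU => ?_
    have : ℓ (tensorPow k U) ∈ Submodule.map ℓ (Submodule.span ℂ
        (Set.range fun U : UN N => tensorPow k (U : Matrix (Fin N) (Fin N) ℂ))) :=
      Submodule.mem_map_of_mem (Submodule.subset_span ⟨⟨U, hU⟩, rfl⟩)
    rw [hker] at this
    simpa using this
  let L : (Fin k → Fin N × Fin N) → ℂ := fun z =>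
    ℓ (Matrix.single (fun t => (z t).1) (fun t => (z t).2) 1)
  have hexp : ∀ X : Matrix (Fin k → Fin N) (Fin k → Fin N) ℂ, ℓ X =
      ∑ z : Fin k → Fin N × Fin N, L z * X (fun t => (z t).1) (fun t => (z t).2) := by
    intro X
    conv_lhs => rw [Matrix.matrix_eq_sum_single X]
    simp only [map_sum]
    rw [← Fintype.sum_prod_type', ← (Equiv.arrowProdEquivProdArrow (Fin k) _ _).sum_comp]
    refine Finset.sum_congr rfl fun z _ => ?_
    rw [mul_comm, ← smul_eq_mul, ← map_smul, Matrix.smul_single, smul_eq_mul, mul_one]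
    rfl
  have hpoly : ∑ z : Fin k → Fin N × Fin N,
      MvPolynomial.monomial (Finsupp.equivFunOnFinite.symm (letterCount z)) (L z) = 0 := by
    refine MvPolynomial.funext fun x => ?_
    rw [map_zero, map_sum, ← hzero (Matrix.of fun i j => x (i, j)), hexp]
    refine Finset.sum_congr rfl fun z _ => ?_
    rw [MvPolynomial.eval_monomial, Finsupp.prod_fintype _ _ (by simp)]
    simp [tensorPow, ← prod_comp_eq_prod_pow_letterCount z x]
  have hcoeff : ∀ m : Fin N × Fin N → ℕ,
      ∑ z : Fin k → Fin N × Fin N, (if letterCount z = m then L z else 0) = 0 := by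
    intro m
    have := congrArg (MvPolynomial.coeff (Finsupp.equivFunOnFinite.symm m)) hpoly
    simpa [MvPolynomial.coeff_sum, MvPolynomial.coeff_monomial] using this
  apply hℓ
  rw [hexp, ← Finset.sum_fiberwise_of_maps_to (t := Finset.univ.image letterCount)
    (g := letterCount) (fun z hz => Finset.mem_image_of_mem _ hz)]
  refine Finset.sum_eq_zero fun m hm => ?_
  obtain ⟨w, -, rfl⟩ := Finset.mem_image.mp hm
  rw [Finset.sum_congr rfl (g := fun z =>
    L z * M (fun t => (w t).1) (fun t => (w t).2)), ← Finset.sum_mul, Finset.sum_filter,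
    hcoeff, zero_mul]
  intro z hz
  rw [apply_eq_of_mem_symTensor hM (Finset.mem_filter.mp hz).2]
/-! ### Complete homogeneous functions and the bialternant formula -/

lemma hMat_congr {N : ℕ} {X Y : Matrix (Fin N) (Fin N) ℂ}
    (h : ∀ m, (X ^ m).trace = (Y ^ m).trace) (k : ℕ) : hMat X k = hMat Y k := by
  induction k using Nat.strong_induction_on with
  | _ k ih =>
    cases k with
    | zero => simp [hMat]
    | succ k =>
      rw [hMat, hMat]
      congr 1
      refine Finset.sum_congr rfl fun m _ => ?_
      rw [h, ih _ (by omega)]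

lemma schur_congr {N : ℕ} (l : Fin N → ℕ) {X Y : Matrix (Fin N) (Fin N) ℂ}
    (h : ∀ m, (X ^ m).trace = (Y ^ m).trace) : schur l X = schur l Y := by
  simp only [schur, hMatZ, hMat_congr h]

lemma LinePoly.pow_apply {N : ℕ} (k : ℕ) (i j : Fin N) :
    LinePoly fun A : Matrix (Fin N) (Fin N) ℂ => (A ^ k) i j := by
  induction k generalizing i j with
  | zero => simpa using LinePoly.const _
  | succ k ih =>
    simp only [pow_succ]
    exact LinePoly.matrix_mul ih LinePoly.apply i j

lemma LinePoly.hMat {N : ℕ} (k : ℕ) :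
    LinePoly fun A : Matrix (Fin N) (Fin N) ℂ => hMat A k := by
  induction k using Nat.strong_induction_on with
  | _ k ih =>
    cases k with
    | zero => simpa [_root_.hMat] using LinePoly.const _
    | succ k =>
      simp only [_root_.hMat]
      exact (LinePoly.const _).mul (LinePoly.sum fun m _ =>
        (LinePoly.sum fun i _ => LinePoly.pow_apply _ i i).mul (ih _ (by omega)))

lemma LinePoly.schur {N : ℕ} (l : Fin N → ℕ) :
    LinePoly fun A : Matrix (Fin N) (Fin N) ℂ => schur l A := by
  refine LinePoly.det fun i j => ?_
  simp only [Matrix.of_apply, hMatZ]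
  split_ifs
  · exact LinePoly.const _
  · exact LinePoly.hMat _

open PowerSeries in
lemma mk_pow_mul_one_sub (a : ℂ) : PowerSeries.mk (fun n => a ^ n) * (1 - C a * X) = 1 := by
  have := congrArg (PowerSeries.rescale a) (PowerSeries.mk_one_mul_one_sub_eq_one ℂ)
  simpa [PowerSeries.rescale_mk] using this

open PowerSeries in
lemma derivative_prod_one_sub {ι : Type*} (s : Finset ι) (x : ι → ℂ) :
    derivative ℂ (∏ i ∈ s, (1 - C (x i) * X)) =
      -(∑ i ∈ s, C (x i) * PowerSeries.mk fun n => x i ^ n) * ∏ i ∈ s, (1 - C (x i) * X) := by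
  induction s using Finset.induction_on with
  | empty => simp
  | insert i s hi ih =>
    have h1 : derivative ℂ (1 - C (x i) * X : PowerSeries ℂ) = -C (x i) := by
      simp
    rw [Finset.prod_insert hi, Finset.sum_insert hi, Derivation.leibniz, ih, h1, smul_eq_mul,
      smul_eq_mul]
    linear_combination (C (x i) * ∏ i ∈ s, (1 - C (x i) * X)) * (mk_pow_mul_one_sub (x i))

lemma trace_diagonal_pow {N : ℕ} (x : Fin N → ℂ) (m : ℕ) :
    (Matrix.diagonal x ^ m).trace = ∑ i, x i ^ m := by
  simp [Matrix.diagonal_pow, Matrix.trace_diagonal]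

open PowerSeries in
lemma mk_hMat_diagonal_mul {N : ℕ} (x : Fin N → ℂ) :
    PowerSeries.mk (hMat (Matrix.diagonal x)) * ∏ i, (1 - C (x i) * X) = 1 := by
  have hH : derivative ℂ (PowerSeries.mk (hMat (Matrix.diagonal x))) =
      (∑ i, C (x i) * PowerSeries.mk fun n => x i ^ n) *
        PowerSeries.mk (hMat (Matrix.diagonal x)) := by
    ext k
    rw [coeff_derivative, coeff_mk, hMat, coeff_mul,
      Finset.Nat.sum_antidiagonal_eq_sum_range_succ_mk]
    have hk : (k : ℂ) + 1 ≠ 0 := Nat.cast_add_one_ne_zero k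
    rw [mul_comm, mul_inv_cancel_left₀ hk]
    refine Finset.sum_congr rfl fun m _ => ?_
    rw [trace_diagonal_pow, map_sum]
    simp [pow_succ']
  apply derivative.ext
  · rw [Derivation.leibniz, hH, derivative_prod_one_sub, smul_eq_mul, smul_eq_mul,
      Derivation.map_one_eq_zero]
    ring
  · simp [hMat, map_prod]

open PowerSeries in
lemma mk_hMat_diagonal_eq_prod {N : ℕ} (x : Fin N → ℂ) :
    PowerSeries.mk (hMat (Matrix.diagonal x)) = ∏ i, PowerSeries.mk fun n => x i ^ n := by
  have h : (∏ i, PowerSeries.mk fun n => x i ^ n) * ∏ i, (1 - C (x i) * X) = 1 := by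
    rw [← Finset.prod_mul_distrib]
    exact Finset.prod_eq_one fun i _ => mk_pow_mul_one_sub _
  calc _ = PowerSeries.mk (hMat (Matrix.diagonal x)) *
        ((∏ i, PowerSeries.mk fun n => x i ^ n) * ∏ i, (1 - C (x i) * X)) := by rw [h, mul_one]
    _ = (PowerSeries.mk (hMat (Matrix.diagonal x)) * ∏ i, (1 - C (x i) * X)) *
        ∏ i, PowerSeries.mk fun n => x i ^ n := by ring
    _ = _ := by rw [mk_hMat_diagonal_mul, one_mul]

lemma hMat_diagonal {N : ℕ} (x : Fin N → ℂ) (n : ℕ) :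
    hMat (Matrix.diagonal x) n = ∑ m : {m : Fin N → ℕ // ∑ i, m i = n}, ∏ i, x i ^ m.1 i := by
  have h := congrArg (PowerSeries.coeff n) (mk_hMat_diagonal_eq_prod x)
  rw [PowerSeries.coeff_mk, PowerSeries.coeff_prod] at h
  rw [h]
  simp only [PowerSeries.coeff_mk]
  refine Finset.sum_bij' (fun m hm => ⟨m, (Finset.mem_finsuppAntidiag.mp hm).1⟩)
    (fun m _ => Finsupp.equivFunOnFinite.symm m.1) ?_ ?_ ?_ ?_ ?_
  · intros; simp
  · intro m _
    simp [Finset.mem_finsuppAntidiag, m.2]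
  · intros; ext; simp
  · intros; ext; simp
  · intros; rfl

open PowerSeries in
lemma coeff_prod_one_sub_eq_zero {ι : Type*} (s : Finset ι) (x : ι → ℂ) {n : ℕ}
    (hn : s.card < n) : coeff n (∏ i ∈ s, (1 - C (x i) * X)) = 0 := by
  induction s using Finset.induction_on generalizing n with
  | empty => simp at hn; simp [coeff_one, hn.ne']
  | insert i s hi ih =>
    rw [Finset.card_insert_of_notMem hi] at hn
    obtain ⟨n, rfl⟩ := Nat.exists_eq_succ_of_ne_zero (by omega : n ≠ 0)
    rw [Finset.prod_insert hi, sub_mul, one_mul, map_sub, mul_assoc, coeff_C_mul,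
      coeff_succ_X_mul, ih (by omega), ih (by omega)]
    simp

/-- The matrix whose `k`-th column lists the coefficients of `∏ i ≠ k, (1 - x i * X)`. -/
def elemMat {N : ℕ} (x : Fin N → ℂ) : Matrix (Fin N) (Fin N) ℂ :=
  Matrix.of fun j k => PowerSeries.coeff (N - 1 - (j : ℕ))
    (∏ i ∈ Finset.univ.erase k, (1 - PowerSeries.C (x i) * PowerSeries.X))

open PowerSeries in
lemma jacobiTrudi_mul_elemMat {N : ℕ} (l : Fin N → ℕ) (x : Fin N → ℂ) :
    (Matrix.of fun i j : Fin N =>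
        hMatZ (Matrix.diagonal x) ((l i : ℤ) - (i : ℤ) + (j : ℤ))) * elemMat x =
      Matrix.of fun i k => x k ^ (l i + (N - 1 - (i : ℕ))) := by
  ext i k
  set Q : PowerSeries ℂ := ∏ i ∈ Finset.univ.erase k, (1 - C (x i) * X) with hQ
  have hmul : PowerSeries.mk (hMat (Matrix.diagonal x)) * Q =
      PowerSeries.mk fun n => x k ^ n := by
    have h1 := mk_hMat_diagonal_mul x
    rw [← Finset.mul_prod_erase _ _ (Finset.mem_univ k), ← hQ] at h1
    linear_combination (PowerSeries.mk fun n => x k ^ n) * h1 -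
      (PowerSeries.mk (hMat (Matrix.diagonal x)) * Q) * mk_pow_mul_one_sub (x k)
  have hi := i.2
  set a := l i + (N - 1 - (i : ℕ)) with ha
  have hco := congrArg (coeff a) hmul
  rw [coeff_mk, coeff_mul, ← Finset.Nat.sum_antidiagonal_swap,
    Finset.Nat.sum_antidiagonal_eq_sum_range_succ_mk] at hco
  simp only [Prod.swap_prod_mk, coeff_mk] at hco
  rw [Matrix.of_apply, ← hco, Matrix.mul_apply, ← Equiv.sum_comp Fin.revPerm]
  have hterm : ∀ b : Fin N, (Matrix.of fun i j : Fin N =>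
      hMatZ (Matrix.diagonal x) ((l i : ℤ) - (i : ℤ) + (j : ℤ))) i (Fin.revPerm b) *
        elemMat x (Fin.revPerm b) k =
      if (b : ℕ) ≤ a then hMat (Matrix.diagonal x) (a - b) * coeff (b : ℕ) Q else 0 := by
    intro b
    have hb := b.2
    have e1 : N - 1 - ((Fin.revPerm b : Fin N) : ℕ) = b := by
      rw [Fin.revPerm_apply, Fin.val_rev]; omega
    have e2 : (l i : ℤ) - (i : ℤ) + ((Fin.revPerm b : Fin N) : ℕ) = (a : ℤ) - b := by
      rw [Fin.revPerm_apply, Fin.val_rev]; omega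
    simp only [Matrix.of_apply, elemMat, e1, e2, hMatZ, ← hQ]
    split_ifs with h1 h2 h2
    · omega
    · simp
    · congr 2
      omega
    · omega
  rw [Finset.sum_congr rfl fun b _ => hterm b,
    Fin.sum_univ_eq_sum_range (fun b => if b ≤ a then
      hMat (Matrix.diagonal x) (a - b) * coeff b Q else 0) N, ← Finset.sum_filter]
  refine Finset.sum_subset_zero_on_sdiff ?_ ?_ fun _ _ => rfl
  · intro b hb
    simp only [Finset.mem_filter, Finset.mem_range] at hb ⊢
    omega
  · intro b hb
    simp only [Finset.mem_sdiff, Finset.mem_filter, Finset.mem_range, not_and] at hb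
    have hbN : N ≤ b := by
      by_contra h
      exact hb.2 (by omega) (by omega)
    rw [hQ, coeff_prod_one_sub_eq_zero, mul_zero]
    rw [Finset.card_erase_of_mem (Finset.mem_univ k), Finset.card_univ, Fintype.card_fin]
    omega

lemma det_elemMat {N : ℕ} (x : Fin N → ℂ) :
    (elemMat x).det = (Matrix.of fun i k : Fin N => x k ^ (N - 1 - (i : ℕ))).det := by
  have h := congrArg Matrix.det (jacobiTrudi_mul_elemMat (fun _ => 0) x)
  rw [Matrix.det_mul, Matrix.det_of_isUpperTriangular] at h
  · simpa [hMatZ, hMat] using h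
  · intro i j hij
    have : (j : ℤ) < i := by exact_mod_cast (show (j : ℕ) < i from hij)
    rw [Matrix.of_apply, hMatZ, if_pos]
    simpa using this

/-- The bialternant formula for the Schur polynomial. -/
lemma schur_diagonal_mul_det {N : ℕ} (l : Fin N → ℕ) (x : Fin N → ℂ) :
    schur l (Matrix.diagonal x) *
        (Matrix.of fun i k : Fin N => x k ^ (N - 1 - (i : ℕ))).det =
      (Matrix.of fun i k : Fin N => x k ^ (l i + (N - 1 - (i : ℕ)))).det := by
  rw [← det_elemMat, schur, ← Matrix.det_mul, jacobiTrudi_mul_elemMat]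
/-! ### Trace of a two-sided multiplication on a product of matrix algebras -/

lemma trace_mulLeftRight_pi {n : ℕ} {d : Fin n → ℕ}
    (a b : Π i, Matrix (Fin (d i)) (Fin (d i)) ℂ) :
    LinearMap.trace ℂ (Π i, Matrix (Fin (d i)) (Fin (d i)) ℂ) (LinearMap.mulLeftRight ℂ (a, b)) =
      ∑ i, (a i).trace * (b i).trace := by
  rw [LinearMap.trace_eq_matrix_trace ℂ
    (Pi.basis fun i => Matrix.stdBasis ℂ (Fin (d i)) (Fin (d i))), Matrix.trace, Fintype.sum_sigma]
  refine Finset.sum_congr rfl fun i _ => ?_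
  rw [Fintype.sum_prod_type, Matrix.trace, Matrix.trace, Finset.sum_mul_sum]
  refine Finset.sum_congr rfl fun p _ => Finset.sum_congr rfl fun q _ => ?_
  rw [Matrix.diag_apply, LinearMap.toMatrix_apply, Pi.basis_repr, Pi.basis_apply,
    LinearMap.mulLeftRight_apply, Matrix.stdBasis_eq_single]
  simp only [Pi.mul_apply, Pi.single_eq_same]
  change (a i * (Matrix.single p q 1 : Matrix (Fin (d i)) (Fin (d i)) ℂ) * b i :
    Matrix (Fin (d i)) (Fin (d i)) ℂ) p q = _
  rw [Matrix.mul_apply, Finset.sum_eq_single q]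
  · simp [Matrix.diag_apply]
  · intro j _ hj
    rw [Matrix.mul_single_apply_of_ne _ _ _ _ _ hj, zero_mul]
  · simp

lemma trace_mulLeftRight_of_algEquiv {S : Type*} [Ring S] [Algebra ℂ S] {n : ℕ} {d : Fin n → ℕ}
    (φ : S ≃ₐ[ℂ] Π i, Matrix (Fin (d i)) (Fin (d i)) ℂ) (a b : S) :
    LinearMap.trace ℂ S (LinearMap.mulLeftRight ℂ (a, b)) =
      ∑ i, (φ a i).trace * (φ b i).trace := by
  rw [← trace_mulLeftRight_pi, ← LinearMap.trace_conj' _ φ.toLinearEquiv]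
  congr 1
  ext x : 1
  simp

lemma exists_nat_trace_of_isIdempotentElem {d : ℕ} {P : Matrix (Fin d) (Fin d) ℂ}
    (hP : P * P = P) : ∃ n : ℕ, P.trace = n := by
  have h : IsIdempotentElem (Matrix.toLin' P) := by
    rw [IsIdempotentElem, Module.End.mul_eq_comp, ← Matrix.toLin'_mul, hP]
  exact ⟨_, (Matrix.trace_toLin'_eq P).symm.trans
    (LinearMap.IsProj.trace (LinearMap.IsIdempotentElem.isProj_range _ h))⟩

/-! ### Weight projections -/

/-- The projection of `(ℂ^N)^{⊗ k}` onto its weight space of weight `α`. -/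
def weightProj {N : ℕ} (k : ℕ) (α : Fin N → ℤ) : symTensor N k :=
  ⟨Matrix.diagonal fun a => if ∀ i, (letterCount a i : ℤ) = α i then 1 else 0,
    diagonal_mem_symTensor fun π a => by rw [letterCount_comp_perm]⟩

/-- The `k`-th tensor power as an element of the algebra of symmetric tensors. -/
def symPow {N : ℕ} (k : ℕ) : Matrix (Fin N) (Fin N) ℂ →* symTensor N k where
  toFun A := ⟨tensorPow k A, tensorPow_mem A⟩
  map_one' := Subtype.ext tensorPow_one
  map_mul' A B := Subtype.ext (tensorPow_mul A B)

lemma weightProj_mul_self {N k : ℕ} (α : Fin N → ℤ) :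
    weightProj k α * weightProj k α = weightProj k α := by
  refine Subtype.ext ?_
  simp [weightProj, Matrix.diagonal_mul_diagonal]

lemma weightProj_eq_zero {N k : ℕ} {α : Fin N → ℤ} {i : Fin N} (h : α i < 0) :
    weightProj k α = 0 := by
  refine Subtype.ext ?_
  change Matrix.diagonal _ = 0
  rw [Matrix.diagonal_eq_zero]
  funext a
  rw [if_neg, Pi.zero_apply]
  exact fun ha => by have := ha i; omega

lemma tensorPow_diagonal {N k : ℕ} (x : Fin N → ℂ) :
    tensorPow k (Matrix.diagonal x) = Matrix.diagonal fun a => ∏ t, x (a t) := by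
  ext a b
  rw [Matrix.diagonal_apply]
  split_ifs with h
  · subst h
    simp [tensorPow]
  · obtain ⟨t, ht⟩ := Function.ne_iff.mp h
    exact Finset.prod_eq_zero (Finset.mem_univ t) (Matrix.diagonal_apply_ne _ ht)

lemma symPow_diagonal {N k : ℕ} (x : Fin N → ℂ) :
    symPow k (Matrix.diagonal x) =
      ∑ m : {m : Fin N → ℕ // ∑ i, m i = k}, (∏ i, x i ^ m.1 i) • weightProj k fun i => m.1 i := by
  refine Subtype.ext ?_
  change tensorPow k (Matrix.diagonal x) = (symTensor N k).val _
  rw [map_sum, tensorPow_diagonal]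
  ext a b
  rw [Matrix.sum_apply, Finset.sum_eq_single ⟨letterCount a, sum_letterCount a⟩]
  · by_cases h : a = b
    · subst h
      simp [weightProj, prod_comp_eq_prod_pow_letterCount a x]
    · simp [weightProj, Matrix.diagonal_apply_ne _ h]
  · intro m _ hm
    have : ¬ ∀ i, letterCount a i = m.1 i := fun h =>
      hm (Subtype.ext (funext fun i => (h i).symm))
    by_cases h : a = b
    · subst h
      simp only [map_smul, Matrix.smul_apply]
      simpa [weightProj] using fun h => absurd h this
    · simp [weightProj, Matrix.diagonal_apply_ne _ h]
  · simp

lemma trace_weightProj_mul_symPow {N k : ℕ} {α : Fin N → ℤ} (hα : ∑ i, α i = k)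
    (x : Fin N → ℂ) :
    LinearMap.trace ℂ (symTensor N k)
        (LinearMap.mulLeftRight ℂ (weightProj k α, symPow k (Matrix.diagonal x))) =
      ∏ i, hMatZ (Matrix.diagonal x) (α i) := by
  by_cases hneg : ∃ i, α i < 0
  · obtain ⟨i, hi⟩ := hneg
    rw [weightProj_eq_zero hi, Finset.prod_eq_zero (Finset.mem_univ i)]
    · rw [show LinearMap.mulLeftRight ℂ ((0 : symTensor N k), symPow k (Matrix.diagonal x)) = 0 by
        ext y : 1; simp, map_zero]
    · simp [hMatZ, hi]
  push Not at hneg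
  lift α to Fin N → ℕ using hneg
  have hα' : ∑ i, α i = k := by
    simp only at hα
    exact_mod_cast hα
  rw [trace_diagonal_mul_mul_diagonal _ _ rfl (tensorPow_diagonal x)]
  have h1 : ∀ m : {m : Fin N × Fin N → ℕ // ∑ p, m p = k},
      (if ∀ i, (letterCount (fun t => (wordOf m t).1) i : ℤ) = α i then (1 : ℂ) else 0) *
        ∏ t, x (wordOf m t).2 =
      if ∀ i, ∑ j, m.1 (i, j) = α i then ∏ p, x p.2 ^ m.1 p else 0 := by
    intro m
    rw [prod_comp_eq_prod_pow_letterCount (wordOf m) (fun p => x p.2), letterCount_wordOf]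
    simp only [letterCount_fst, letterCount_wordOf, Nat.cast_inj, ite_mul, one_mul, zero_mul]
  have h2 : ∀ i, hMatZ (Matrix.diagonal x) (α i : ℤ) =
      ∑ m : {m : Fin N → ℕ // ∑ j, m j = α i}, ∏ j, x j ^ m.1 j := fun i => by
    rw [hMatZ, if_neg (by omega), Int.toNat_natCast, hMat_diagonal]
  rw [Finset.sum_congr rfl fun m _ => h1 m, Finset.prod_congr rfl fun i _ => h2 i,
    Finset.prod_univ_sum, ← Finset.sum_filter]
  refine Finset.sum_bij' (fun m hm i => ⟨fun j => m.1 (i, j), (Finset.mem_filter.mp hm).2 i⟩)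
    (fun f _ => ⟨fun p => (f p.1).1 p.2, ?_⟩) ?_ ?_ ?_ ?_ ?_
  · rw [Fintype.sum_prod_type, ← hα']
    exact Finset.sum_congr rfl fun i _ => (f i).2
  · intros; simp
  · intro f _
    simp only [Finset.mem_filter, Finset.mem_univ, true_and]
    exact fun i => (f i).2
  · intros; rfl
  · intros; rfl
  · intro m _
    exact Fintype.prod_prod_type _

/-! ### The irreducible representation with character the Schur polynomial -/

lemma sum_ite_eq_of_forall_sum_eq {σ ι κ : Type*} [Fintype σ] [Fintype ι] [Fintype κ]
    {c : ι → ℂ} {e : ι → σ → ℕ} {c' : κ → ℂ} {e' : κ → σ → ℕ}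
    (h : ∀ x : σ → ℂ, ∑ s, c s * ∏ i, x i ^ e s i = ∑ s, c' s * ∏ i, x i ^ e' s i) (m : σ → ℕ) :
    (∑ s, if e s = m then c s else 0) = ∑ s, if e' s = m then c' s else 0 := by
  have hP : ∑ s, MvPolynomial.monomial (Finsupp.equivFunOnFinite.symm (e s)) (c s) =
      ∑ s, MvPolynomial.monomial (Finsupp.equivFunOnFinite.symm (e' s)) (c' s) := by
    refine MvPolynomial.funext fun x => ?_
    simpa [MvPolynomial.eval_monomial, Finsupp.prod_fintype] using h x
  simpa [MvPolynomial.coeff_sum, MvPolynomial.coeff_monomial] using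
    congrArg (MvPolynomial.coeff (Finsupp.equivFunOnFinite.symm m)) hP

/-- The exponents in the expansion of the Jacobi-Trudi determinant. -/
def jacobiTrudiWeight {N : ℕ} (l : Fin N → ℕ) (w : Equiv.Perm (Fin N)) (i : Fin N) : ℤ :=
  (l i : ℤ) - (i : ℤ) + (w i : ℤ)

lemma sum_jacobiTrudiWeight {N : ℕ} (l : Fin N → ℕ) (w : Equiv.Perm (Fin N)) :
    ∑ i, jacobiTrudiWeight l w i = (∑ i, l i : ℕ) := by
  simp only [jacobiTrudiWeight, Finset.sum_add_distrib, Finset.sum_sub_distrib]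
  rw [Equiv.sum_comp w fun i => (i : ℤ)]
  push_cast
  ring

lemma schur_eq_sum {N : ℕ} (l : Fin N → ℕ) (X : Matrix (Fin N) (Fin N) ℂ) :
    schur l X = ∑ w : Equiv.Perm (Fin N), (Equiv.Perm.sign w : ℂ) *
      ∏ i, hMatZ X (jacobiTrudiWeight l w i) := by
  rw [schur, ← Matrix.det_transpose, Matrix.det_apply']
  rfl

section Wedderburn

variable {N : ℕ} (l : Fin N → ℕ) {r : ℕ} {d : Fin r → ℕ}
  (φ : symTensor N (∑ i, l i) ≃ₐ[ℂ] Π i, Matrix (Fin (d i)) (Fin (d i)) ℂ)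

/-- The multiplicity of the Schur polynomial in the `i`-th irreducible character of the algebra
of symmetric tensors. -/
def schurCoeff (i : Fin r) : ℂ :=
  ∑ w : Equiv.Perm (Fin N), (Equiv.Perm.sign w : ℂ) *
    (φ (weightProj _ (jacobiTrudiWeight l w)) i).trace

lemma exists_nat_trace_weightProj (α : Fin N → ℤ) (i : Fin r) :
    ∃ n : ℕ, (φ (weightProj _ α) i).trace = n :=
  exists_nat_trace_of_isIdempotentElem (by
    rw [← Pi.mul_apply, ← map_mul, weightProj_mul_self])

lemma exists_int_schurCoeff (i : Fin r) : ∃ z : ℤ, schurCoeff l φ i = z := by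
  choose n hn using fun α => exists_nat_trace_weightProj l φ α i
  exact ⟨∑ w : Equiv.Perm (Fin N), (Equiv.Perm.sign w : ℤ) * n (jacobiTrudiWeight l w),
    by simp [schurCoeff, hn]⟩

lemma sum_schurCoeff_mul_trace_diagonal (x : Fin N → ℂ) :
    ∑ i, schurCoeff l φ i * (φ (symPow _ (Matrix.diagonal x)) i).trace =
      schur l (Matrix.diagonal x) := by
  simp only [schur_eq_sum, schurCoeff, Finset.sum_mul]
  rw [Finset.sum_comm]
  refine Finset.sum_congr rfl fun w _ => ?_
  simp only [mul_assoc]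
  rw [← Finset.mul_sum, ← trace_mulLeftRight_of_algEquiv φ,
    trace_weightProj_mul_symPow (sum_jacobiTrudiWeight l w)]

lemma sum_schurCoeff_mul_trace_of_isHermitian {A : Matrix (Fin N) (Fin N) ℂ}
    (hA : A.IsHermitian) :
    ∑ i, schurCoeff l φ i * (φ (symPow _ A) i).trace = schur l A := by
  obtain ⟨U, V, x, hVU, rfl⟩ : ∃ (U V : Matrix (Fin N) (Fin N) ℂ) (x : Fin N → ℂ),
      V * U = 1 ∧ A = U * Matrix.diagonal x * V :=
    ⟨hA.eigenvectorUnitary, star (hA.eigenvectorUnitary : Matrix (Fin N) (Fin N) ℂ), _,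
      Unitary.coe_star_mul_self _, hA.spectral_theorem⟩
  have hpow : ∀ m, ((U * Matrix.diagonal x * V) ^ m).trace = (Matrix.diagonal x ^ m).trace := by
    intro m
    have : (U * Matrix.diagonal x * V) ^ m = U * Matrix.diagonal x ^ m * V := by
      induction m with
      | zero => simp [mul_eq_one_comm.mp hVU]
      | succ m ih =>
        rw [pow_succ, ih, pow_succ]
        calc _ = U * Matrix.diagonal x ^ m * (V * U) * Matrix.diagonal x * V := by
              simp only [Matrix.mul_assoc]
          _ = _ := by rw [hVU, Matrix.mul_one]; simp only [Matrix.mul_assoc]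
    rw [this, Matrix.trace_mul_comm, ← Matrix.mul_assoc, hVU, Matrix.one_mul]
  rw [schur_congr l hpow, ← sum_schurCoeff_mul_trace_diagonal l φ x]
  refine Finset.sum_congr rfl fun i _ => ?_
  rw [map_mul, map_mul, map_mul, map_mul, Pi.mul_apply, Pi.mul_apply, Matrix.trace_mul_comm,
    ← Matrix.mul_assoc, ← Pi.mul_apply, ← map_mul, ← map_mul, hVU, map_one, map_one, Pi.one_apply,
    Matrix.one_mul]

lemma sum_schurCoeff_mul_trace (A : Matrix (Fin N) (Fin N) ℂ) :
    ∑ i, schurCoeff l φ i * (φ (symPow _ A) i).trace = schur l A := by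
  let ℓ : symTensor N (∑ i, l i) →ₗ[ℂ] ℂ :=
    ∑ i, schurCoeff l φ i • (Matrix.traceLinearMap (Fin (d i)) ℂ ℂ ∘ₗ LinearMap.proj i ∘ₗ
      φ.toLinearMap)
  obtain ⟨L, hL⟩ := LinearMap.exists_extend (p := Subalgebra.toSubmodule (symTensor N _)) ℓ
  have h : ∀ A, L (tensorPow _ A) = ∑ i, schurCoeff l φ i * (φ (symPow _ A) i).trace := fun A => by
    have := LinearMap.congr_fun hL (symPow _ A)
    simpa [ℓ, symPow] using this
  have hpoly : LinePoly fun A => L (tensorPow _ A) + (-1) * schur l A :=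
    (LinePoly.linear_tensorPow L LinePoly.apply).add
      ((LinePoly.const _).mul (LinePoly.schur l))
  have := hpoly.eq_zero_of_isHermitian (fun H hH => by
    rw [h, sum_schurCoeff_mul_trace_of_isHermitian l φ hH]; ring) A
  rw [h] at this
  linear_combination this

lemma det_of_pow {N : ℕ} (a : Fin N → ℕ) (x : Fin N → ℂ) :
    (Matrix.of fun i k : Fin N => x k ^ a i).det =
      ∑ w : Equiv.Perm (Fin N), (Equiv.Perm.sign w : ℂ) * ∏ k, x k ^ a (w k) := by
  rw [Matrix.det_apply']
  rfl

lemma sum_schurCoeff_sq (hl : Antitone l) : ∑ i, schurCoeff l φ i ^ 2 = 1 := by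
  set F : (Fin N → ℤ) → ℂ := fun α => ∑ i, schurCoeff l φ i * (φ (weightProj _ α) i).trace with hF
  have hschur : ∀ x : Fin N → ℂ, schur l (Matrix.diagonal x) =
      ∑ m : {m : Fin N → ℕ // ∑ i, m i = ∑ i, l i}, F (fun i => m.1 i) * ∏ i, x i ^ m.1 i := by
    intro x
    rw [← sum_schurCoeff_mul_trace_diagonal l φ x, symPow_diagonal]
    simp only [map_sum, map_smul, Finset.sum_apply, Pi.smul_apply, Matrix.trace_sum,
      Matrix.trace_smul, hF, Finset.sum_mul, Finset.mul_sum, smul_eq_mul]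
    rw [Finset.sum_comm]
    exact Finset.sum_congr rfl fun m _ => Finset.sum_congr rfl fun i _ => by ring
  have hid : ∀ x : Fin N → ℂ,
      (∑ s : {m : Fin N → ℕ // ∑ i, m i = ∑ i, l i} × Equiv.Perm (Fin N),
        (F (fun i => s.1.1 i) * (Equiv.Perm.sign s.2 : ℂ)) *
          ∏ k, x k ^ (s.1.1 k + (N - 1 - (s.2 k : ℕ)))) =
      ∑ w : Equiv.Perm (Fin N), (Equiv.Perm.sign w : ℂ) *
          ∏ k, x k ^ (l (w k) + (N - 1 - (w k : ℕ))) := by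
    intro x
    rw [← det_of_pow (fun i => l i + (N - 1 - (i : ℕ))), ← schur_diagonal_mul_det, hschur,
      det_of_pow (fun i => N - 1 - (i : ℕ)), Finset.sum_mul_sum, Fintype.sum_prod_type]
    refine Finset.sum_congr rfl fun m _ => Finset.sum_congr rfl fun w _ => ?_
    simp only [pow_add, Finset.prod_mul_distrib]
    ring
  have hcoeff := sum_ite_eq_of_forall_sum_eq hid fun k => l k + (N - 1 - (k : ℕ))
  have hanti : StrictAnti fun k : Fin N => l k + (N - 1 - (k : ℕ)) := fun i j hij => by
    have := hl hij.le
    have := j.2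
    have : (i : ℕ) < j := hij
    simp only
    omega
  rw [Finset.sum_eq_single (1 : Equiv.Perm (Fin N)), if_pos (by rfl),
    Fintype.sum_prod_type_right] at hcoeff
  · have hw : ∀ w : Equiv.Perm (Fin N),
        (∑ m : {m : Fin N → ℕ // ∑ i, m i = ∑ i, l i},
          if (fun k => m.1 k + (N - 1 - (w k : ℕ))) = fun k => l k + (N - 1 - (k : ℕ)) then
            F (fun i => m.1 i) * (Equiv.Perm.sign w : ℂ) else 0) =
        (Equiv.Perm.sign w : ℂ) * F (jacobiTrudiWeight l w) := by
      intro w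
      have hiff : ∀ m : Fin N → ℕ,
          ((fun k => m k + (N - 1 - (w k : ℕ))) = fun k => l k + (N - 1 - (k : ℕ))) ↔
            (fun k => (m k : ℤ)) = jacobiTrudiWeight l w := by
        intro m
        simp only [funext_iff, jacobiTrudiWeight]
        refine forall_congr' fun k => ?_
        have := (w k).2
        have := k.2
        omega
      by_cases hneg : ∃ i, jacobiTrudiWeight l w i < 0
      · obtain ⟨i, hi⟩ := hneg
        rw [hF]
        simp only [weightProj_eq_zero hi]
        rw [Finset.sum_eq_zero]
        · simp
        · intro m _
          rw [if_neg]
          rw [hiff]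
          intro h
          have := congrFun h i
          omega
      · push Not at hneg
        have hsum := sum_jacobiTrudiWeight l w
        generalize jacobiTrudiWeight l w = α at *
        lift α to Fin N → ℕ using hneg
        simp only at hsum
        rw [Finset.sum_eq_single ⟨α, by exact_mod_cast hsum⟩, if_pos, mul_comm]
        · exact (hiff _).mpr rfl
        · intro m _ hm
          rw [if_neg]
          rw [hiff]
          intro h
          exact hm (Subtype.ext (funext fun k => by exact_mod_cast congrFun h k))
        · simp
    rw [Finset.sum_congr rfl fun w _ => hw w] at hcoeff
    rw [hF] at hcoeff
    simp only [Finset.mul_sum] at hcoeff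
    rw [Finset.sum_comm] at hcoeff
    simp only [Equiv.Perm.sign_one, Units.val_one, Int.cast_one] at hcoeff
    rw [← hcoeff]
    refine Finset.sum_congr rfl fun i _ => ?_
    conv_lhs => rw [sq, ← smul_eq_mul]; arg 2; rw [schurCoeff]
    rw [smul_eq_mul, Finset.mul_sum]
    exact Finset.sum_congr rfl fun w _ => by ring
  · intro w _ hw
    rw [if_neg]
    intro h
    exact hw (Equiv.ext fun k => hanti.injective (congrFun h k))
  · simp

end Wedderburn

lemma exists_pos_det_two_pow {N : ℕ} {a : Fin N → ℕ} (ha : StrictAnti a) :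
    ∃ r : ℝ, 0 < r ∧ (Matrix.of fun i k : Fin N => ((2 : ℂ) ^ (k : ℕ)) ^ a i).det =
      (∏ i : Fin N, ∏ _j ∈ Finset.Ioi i, (-1 : ℂ)) * r := by
  refine ⟨∏ i : Fin N, ∏ j ∈ Finset.Ioi i, ((2 : ℝ) ^ a i - 2 ^ a j), ?_, ?_⟩
  · refine Finset.prod_pos fun i _ => Finset.prod_pos fun j hj => sub_pos.mpr ?_
    exact pow_lt_pow_right₀ one_lt_two (ha (Finset.mem_Ioi.mp hj))
  · have : (Matrix.of fun i k : Fin N => ((2 : ℂ) ^ (k : ℕ)) ^ a i) =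
        Matrix.vandermonde fun i => (2 : ℂ) ^ a i := by
      ext i k
      simp only [Matrix.of_apply, Matrix.vandermonde_apply]
      rw [← pow_mul, ← pow_mul, mul_comm]
    rw [this, Matrix.det_vandermonde]
    push_cast
    rw [← Finset.prod_mul_distrib]
    refine Finset.prod_congr rfl fun i _ => ?_
    rw [← Finset.prod_mul_distrib]
    exact Finset.prod_congr rfl fun j _ => by ring

lemma exists_pos_schur_two_pow {N : ℕ} {l : Fin N → ℕ} (hl : Antitone l) :
    ∃ r s : ℝ, 0 < r ∧ 0 < s ∧
      schur l (Matrix.diagonal fun k : Fin N => (2 : ℂ) ^ (k : ℕ)) * r = s := by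
  have h0 : StrictAnti fun k : Fin N => N - 1 - (k : ℕ) := fun i j hij => by
    have := j.2
    have : (i : ℕ) < j := hij
    simp only
    omega
  have h1 : StrictAnti fun k : Fin N => l k + (N - 1 - (k : ℕ)) := fun i j hij => by
    have := hl hij.le
    have := h0 hij
    simp only at *
    omega
  obtain ⟨r, hr, hr'⟩ := exists_pos_det_two_pow h0
  obtain ⟨s, hs, hs'⟩ := exists_pos_det_two_pow h1
  refine ⟨r, s, hr, hs, ?_⟩
  have h := schur_diagonal_mul_det l fun k : Fin N => (2 : ℂ) ^ (k : ℕ)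
  rw [hr', hs'] at h
  have hne : (∏ i : Fin N, ∏ _j ∈ Finset.Ioi i, (-1 : ℂ)) ≠ 0 := by
    simp [Finset.prod_ne_zero_iff]
  exact mul_left_cancel₀ hne (by linear_combination h)

lemma exists_eq_one_of_sum_sq_eq_one {ι : Type*} [Fintype ι] {z : ι → ℤ}
    (h : ∑ i, z i ^ 2 = 1) : ∃ i, (z i = 1 ∨ z i = -1) ∧ ∀ j, j ≠ i → z j = 0 := by
  obtain ⟨i, hi⟩ : ∃ i, z i ≠ 0 := by
    by_contra! h0
    simp [h0] at h
  have hsplit := Finset.add_sum_erase Finset.univ (fun i => z i ^ 2) (Finset.mem_univ i)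
  have hnn : 0 ≤ ∑ j ∈ Finset.univ.erase i, z j ^ 2 := Finset.sum_nonneg fun j _ => sq_nonneg _
  have hpos : 0 < z i ^ 2 := by positivity
  have h0 : ∑ j ∈ Finset.univ.erase i, z j ^ 2 = 0 := by omega
  refine ⟨i, sq_eq_one_iff.mp ?_, fun j hj => ?_⟩
  · omega
  · exact pow_eq_zero_iff two_ne_zero |>.mp ((Finset.sum_eq_zero_iff_of_nonneg
      fun j _ => sq_nonneg _).mp h0 j (by simp [hj]))

/-- The Schur polynomial of the partition `l` is the character of an irreducible representation
of the algebra of symmetric tensors. -/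
theorem exists_surjective_trace_eq_schur {N : ℕ} {l : Fin N → ℕ} (hl : Antitone l) :
    ∃ (d : ℕ) (_ : NeZero d) (ρ : symTensor N (∑ i, l i) →ₐ[ℂ] Matrix (Fin d) (Fin d) ℂ),
      Function.Surjective ρ ∧ ∀ A, (ρ (symPow _ A)).trace = schur l A := by
  have : IsSemisimpleRing (symTensor N (∑ i, l i)) :=
    Subalgebra.isSemisimpleRing_of_conjTranspose_mem _ fun _ => conjTranspose_mem_symTensor
  obtain ⟨r, d, hd, ⟨φ⟩⟩ :=
    IsSemisimpleRing.exists_algEquiv_pi_matrix_of_isAlgClosed ℂ (symTensor N (∑ i, l i))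
  choose z hz using exists_int_schurCoeff l φ
  obtain ⟨i, hi, hi'⟩ := exists_eq_one_of_sum_sq_eq_one (z := z) (by
    have := sum_schurCoeff_sq l φ hl
    simp only [hz] at this
    exact_mod_cast this)
  have hchar : ∀ A, (z i : ℂ) * (φ (symPow _ A) i).trace = schur l A := fun A => by
    rw [← sum_schurCoeff_mul_trace l φ A, Finset.sum_eq_single i, hz]
    · intro j _ hj
      simp [hz, hi' j hj]
    · simp
  have hi1 : z i = 1 := by
    refine hi.resolve_right fun hneg => ?_
    obtain ⟨s, t, hs, ht, hst⟩ := exists_pos_schur_two_pow hl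
    choose n hn using fun α => exists_nat_trace_weightProj l φ α i
    have hnat : ∃ q : ℕ, (φ (symPow _ (Matrix.diagonal fun k : Fin N => (2 : ℂ) ^ (k : ℕ)))
        i).trace = q := by
      refine ⟨∑ m : {m : Fin N → ℕ // ∑ i, m i = ∑ i, l i},
        (∏ k : Fin N, (2 ^ (k : ℕ)) ^ m.1 k) * n fun k => m.1 k, ?_⟩
      rw [symPow_diagonal]
      simp [Matrix.trace_sum, hn]
    obtain ⟨q, hq⟩ := hnat
    rw [← hchar, hneg, hq] at hst
    have : (-1 : ℝ) * q * s = t := by exact_mod_cast hst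
    have : (0 : ℝ) ≤ q * s := by positivity
    linarith
  refine ⟨d i, hd i, (Pi.evalAlgHom ℂ _ i).comp φ.toAlgHom, ?_, fun A => ?_⟩
  · exact (Function.surjective_eval i).comp φ.surjective
  · rw [← hchar, hi1]
    simp

/-! ### Schur orthogonality -/

instance (N : ℕ) : BorelSpace (UN N) := ⟨rfl⟩

instance (N : ℕ) : BorelSpace (SUN N) := ⟨rfl⟩

instance (N : ℕ) : CompactSpace (UN N) := by
  refine isCompact_iff_compactSpace.mp (IsCompact.of_isClosed_subset
    (isCompact_univ_pi fun _ : Fin N => isCompact_univ_pi fun _ : Fin N =>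
      isCompact_closedBall (0 : ℂ) 1) isClosed_unitary ?_)
  intro U hU i _ j _
  simpa using entry_norm_bound_of_unitary hU i j

instance (N : ℕ) : CompactSpace (SUN N) := by
  refine isCompact_iff_compactSpace.mp (IsClosed.isCompact ?_)
  exact isClosed_eq (Continuous.matrix_det continuous_subtype_val) continuous_const

lemma exists_eq_smul_of_mem_SUN {N : ℕ} (hN : 1 ≤ N) (U : UN N) :
    ∃ (z : ℂ) (V : SUN N), (U : Matrix (Fin N) (Fin N) ℂ) = z • ((V : UN N) : Matrix _ _ ℂ) := by
  have hdet : ‖(U : Matrix (Fin N) (Fin N) ℂ).det‖ = 1 :=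
    CStarRing.norm_of_mem_unitary (Matrix.det_of_mem_unitary U.2)
  obtain ⟨z, hz⟩ := IsAlgClosed.exists_pow_nat_eq (U : Matrix (Fin N) (Fin N) ℂ).det hN
  have hz1 : ‖z‖ = 1 := by
    rw [← hz, norm_pow] at hdet
    exact (pow_eq_one_iff_of_nonneg (norm_nonneg z) (by omega)).mp hdet
  have hz0 : z ≠ 0 := norm_ne_zero_iff.mp (by rw [hz1]; exact one_ne_zero)
  have hzz : star z⁻¹ * z⁻¹ = 1 := by
    rw [Complex.star_def, ← Complex.normSq_eq_conj_mul_self, Complex.normSq_eq_norm_sq]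
    simp [hz1]
  have hmem : z⁻¹ • (U : Matrix (Fin N) (Fin N) ℂ) ∈ Matrix.unitaryGroup (Fin N) ℂ := by
    rw [Matrix.mem_unitaryGroup_iff', star_smul, Matrix.smul_mul, Matrix.mul_smul, smul_smul, hzz,
      one_smul]
    exact Matrix.mem_unitaryGroup_iff'.mp U.2
  refine ⟨z, ⟨⟨_, hmem⟩, ?_⟩, ?_⟩
  · change (z⁻¹ • (U : Matrix (Fin N) (Fin N) ℂ)).det = 1
    rw [Matrix.det_smul, Fintype.card_fin, inv_pow, hz, inv_mul_cancel₀]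
    rw [← hz]
    exact pow_ne_zero _ hz0
  · simp [smul_smul, hz0]

lemma continuous_map_symPow {N k d : ℕ} (ρ : symTensor N k →ₐ[ℂ] Matrix (Fin d) (Fin d) ℂ)
    (p q : Fin d) : Continuous fun A => ρ (symPow k A) p q := by
  let ℓ : symTensor N k →ₗ[ℂ] ℂ := Matrix.entryLinearMap ℂ ℂ p q ∘ₗ ρ.toLinearMap
  obtain ⟨L, hL⟩ := LinearMap.exists_extend (p := Subalgebra.toSubmodule (symTensor N _)) ℓ
  have h : (fun A => ρ (symPow k A) p q) = fun A => L (tensorPow k A) := funext fun A => by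
    have := LinearMap.congr_fun hL (symPow _ A)
    simpa [ℓ, symPow] using this.symm
  rw [h]
  refine (LinearMap.continuous_of_finiteDimensional L).comp (continuous_matrix fun a b => ?_)
  exact continuous_finsetProd Finset.univ fun t _ =>
    (continuous_id (X := Matrix (Fin N) (Fin N) ℂ)).matrix_elem (a t) (b t)

lemma exists_eq_smul_one_of_commute_symPow {N k d : ℕ}
    {ρ : symTensor N k →ₐ[ℂ] Matrix (Fin d) (Fin d) ℂ} (hρ : Function.Surjective ρ)
    {M : Matrix (Fin d) (Fin d) ℂ} (hM : ∀ U : UN N, Commute (ρ (symPow k U)) M) :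
    ∃ c : ℂ, M = c • 1 := by
  have hall : ∀ s, Commute (ρ s) M := by
    intro s
    have : ∃ h : (s : Matrix _ _ ℂ) ∈ symTensor N k, Commute (ρ ⟨s, h⟩) M := by
      refine Submodule.span_induction (p := fun x _ => ∃ h : x ∈ symTensor N k,
        Commute (ρ ⟨x, h⟩) M) ?_ ?_ ?_ ?_ (mem_span_tensorPow_unitary s.2)
      · rintro _ ⟨U, rfl⟩
        exact ⟨tensorPow_mem _, hM U⟩
      · refine ⟨zero_mem _, ?_⟩
        have : (⟨0, zero_mem _⟩ : symTensor N k) = 0 := rfl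
        rw [this, map_zero]
        exact Commute.zero_left M
      · rintro x y _ _ ⟨hx, hx'⟩ ⟨hy, hy'⟩
        refine ⟨add_mem hx hy, ?_⟩
        have : (⟨x + y, add_mem hx hy⟩ : symTensor N k) = ⟨x, hx⟩ + ⟨y, hy⟩ := rfl
        rw [this, map_add]
        exact hx'.add_left hy'
      · rintro a x _ ⟨hx, hx'⟩
        refine ⟨Subalgebra.smul_mem _ hx a, ?_⟩
        have : (⟨a • x, Subalgebra.smul_mem _ hx a⟩ : symTensor N k) = a • ⟨x, hx⟩ := rfl
        rw [this, map_smul]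
        exact hx'.smul_left a
    exact this.2
  obtain ⟨c, hc⟩ := Matrix.mem_range_scalar_of_commute_single (M := M) fun i j _ => by
    obtain ⟨s, hs⟩ := hρ (Matrix.single i j 1)
    rw [← hs]
    exact hall s
  exact ⟨c, by rw [← hc]; simp [Matrix.smul_one_eq_diagonal]⟩

lemma integrable_apply_mul_apply_inv {G : Type*} [Group G] [TopologicalSpace G]
    [IsTopologicalGroup G] [CompactSpace G] [MeasurableSpace G] [BorelSpace G] (μ : Measure G)
    [μ.IsHaarMeasure] {d : ℕ} {ψ : G →* Matrix (Fin d) (Fin d) ℂ}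
    (hψ : ∀ p q, Continuous fun g => ψ g p q) (p q r s : Fin d) :
    Integrable (fun g => ψ g p q * ψ g⁻¹ r s) μ :=
  (Continuous.mul (hψ p q) ((hψ r s).comp continuous_inv)).integrable_of_hasCompactSupport
    (HasCompactSupport.of_compactSpace _)

/-- Schur orthogonality for an absolutely irreducible matrix representation of a compact group. -/
lemma integral_apply_mul_apply_inv {G : Type*} [Group G] [TopologicalSpace G]
    [IsTopologicalGroup G] [CompactSpace G] [MeasurableSpace G] [BorelSpace G] (μ : Measure G)
    [μ.IsHaarMeasure] [IsProbabilityMeasure μ] {d : ℕ} [NeZero d]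
    {ψ : G →* Matrix (Fin d) (Fin d) ℂ} (hψ : ∀ p q, Continuous fun g => ψ g p q)
    (hirr : ∀ M, (∀ g, Commute (ψ g) M) → ∃ c : ℂ, M = c • 1) (p q r s : Fin d) :
    ∫ g, ψ g p q * ψ g⁻¹ r s ∂μ = if p = s ∧ q = r then (d : ℂ)⁻¹ else 0 := by
  have hprod := integrable_apply_mul_apply_inv μ hψ
  obtain ⟨c, hc⟩ := hirr (Matrix.of fun p s => ∫ g, ψ g p q * ψ g⁻¹ r s ∂μ) fun h => by
    ext p s
    simp only [Matrix.mul_apply, Matrix.of_apply, ← integral_const_mul, ← integral_mul_const]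
    rw [← integral_finsetSum _ fun t _ => (hprod _ _ _ _).const_mul _,
      ← integral_finsetSum _ fun t _ => (hprod _ _ _ _).mul_const _]
    refine Eq.trans ?_ (integral_mul_left_eq_self _ h)
    refine integral_congr_ae (Filter.Eventually.of_forall fun g => ?_)
    have hinv : ψ g⁻¹ r s = ∑ t, ψ (h * g)⁻¹ r t * ψ h t s := by
      rw [← Matrix.mul_apply, ← map_mul, _root_.mul_inv_rev, inv_mul_cancel_right]
    simp only [hinv, map_mul, Matrix.mul_apply, Finset.sum_mul, Finset.mul_sum, mul_assoc]
    exact Finset.sum_comm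
  have happ : ∀ p s, ∫ g, ψ g p q * ψ g⁻¹ r s ∂μ = if p = s then c else 0 := fun p s => by
    have := congrFun (congrFun hc p) s
    simpa [Matrix.one_apply] using this
  have htrace : (d : ℂ) * c = if q = r then 1 else 0 := by
    calc (d : ℂ) * c = ∑ p, ∫ g, ψ g p q * ψ g⁻¹ r p ∂μ := by simp [happ]
      _ = ∫ g, ∑ p, ψ g⁻¹ r p * ψ g p q ∂μ := by
        rw [← integral_finsetSum _ fun t _ => hprod _ _ _ _]
        simp only [mul_comm]
      _ = _ := by
        simp only [← Matrix.mul_apply, ← map_mul, inv_mul_cancel, map_one, integral_const]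
        simp [Matrix.one_apply, eq_comm]
  have hd : (d : ℂ) ≠ 0 := NeZero.ne _
  rw [happ, show c = (d : ℂ)⁻¹ * if q = r then 1 else 0 by rw [← htrace]; field_simp]
  by_cases h1 : p = s <;> by_cases h2 : q = r <;> simp [h1, h2]

/-! ### Products of traces over the cycles of a permutation -/

lemma list_prod_apply_eq_sum {d : ℕ} (m : ℕ) (A : ℕ → Matrix (Fin d) (Fin d) ℂ) (a b : Fin d) :
    ((List.range (m + 1)).map A).prod a b = ∑ q : Fin m → Fin d, ∏ t : Fin (m + 1),
      A t (Fin.cons (α := fun _ => Fin d) a q t) (Fin.snoc (α := fun _ => Fin d) q b t) := by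
  induction m generalizing A a with
  | zero => simp [Fin.snoc]
  | succ m ih =>
    rw [List.range_succ_eq_map, List.map_cons, List.prod_cons, List.map_map, Matrix.mul_apply,
      ← (Fin.consEquiv fun _ : Fin (m + 1) => Fin d).sum_comp, Fintype.sum_prod_type]
    refine Finset.sum_congr rfl fun c _ => ?_
    rw [ih, Finset.mul_sum]
    refine Finset.sum_congr rfl fun q _ => ?_
    rw [Fin.prod_univ_succ (n := m + 1)]
    have h := Fin.cons_snoc_eq_snoc_cons c q b
    simp only [Fin.consEquiv_apply, Fin.cons_zero, Fin.cons_succ]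
    erw [← h]
    rfl

lemma trace_list_prod_eq_sum {d m : ℕ} (hm : 0 < m) (A : ℕ → Matrix (Fin d) (Fin d) ℂ) :
    ((List.range m).map A).prod.trace =
      ∑ p : Fin m → Fin d, ∏ t : Fin m, A t (p t) (p (finRotate m t)) := by
  obtain ⟨m, rfl⟩ := Nat.exists_eq_add_one_of_ne_zero hm.ne'
  rw [Matrix.trace, ← (Fin.consEquiv fun _ : Fin (m + 1) => Fin d).sum_comp, Fintype.sum_prod_type]
  refine Finset.sum_congr rfl fun a _ => ?_
  rw [Matrix.diag_apply, list_prod_apply_eq_sum]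
  refine Finset.sum_congr rfl fun q _ => Finset.prod_congr rfl fun t _ => ?_
  simp only [Fin.consEquiv_apply]
  congr 1
  induction t using Fin.lastCases with
  | last => simp
  | cast i => simp

lemma pow_finRotate_apply {α : Type*} (σ : Equiv.Perm α) {x : α} {m : ℕ} (h : (σ ^ m) x = x)
    (t : Fin m) : (σ ^ (finRotate m t : ℕ)) x = σ ((σ ^ (t : ℕ)) x) := by
  cases m with
  | zero => exact t.elim0
  | succ m =>
    rw [← Equiv.Perm.mul_apply, ← pow_succ']
    induction t using Fin.lastCases with
    | last => simpa using h.symm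
    | cast i => simp

section Cycles

variable {α : Type*} (σ : Equiv.Perm α)

lemma minimalPeriod_perm_pos [Finite α] (x : α) : 0 < Function.minimalPeriod σ x :=
  Function.minimalPeriod_pos_of_mem_periodicPts
    (σ.injective.mem_periodicPts x)

lemma pow_minimalPeriod_apply (x : α) : (σ ^ Function.minimalPeriod σ x) x = x := by
  rw [← Equiv.Perm.iterate_eq_pow]
  exact Function.iterate_minimalPeriod

lemma bijective_pow_apply [Finite α] {R : Finset α} (hR : ∀ x, ∃! r, r ∈ R ∧ σ.SameCycle r x) :
    Function.Bijective fun s : Σ f : R, Fin (Function.minimalPeriod σ (f : α)) =>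
      (σ ^ (s.2 : ℕ)) (s.1 : α) := by
  constructor
  · rintro ⟨⟨f, hf⟩, t⟩ ⟨⟨f', hf'⟩, t'⟩ h
    simp only at h t t'
    obtain rfl : f = f' := (hR ((σ ^ (t : ℕ)) f)).unique ⟨hf, t, by simp⟩
      ⟨hf', t', by rw [h]; simp⟩
    congr 1
    refine Fin.ext (Function.iterate_injOn_Iio_minimalPeriod (f := σ) (x := f) t.2 t'.2 ?_)
    simpa only [Equiv.Perm.iterate_eq_pow] using h
  · intro x
    obtain ⟨r, ⟨hr, hrx⟩, -⟩ := hR x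
    obtain ⟨i, hi⟩ := hrx.exists_nat_pow_eq
    refine ⟨⟨⟨r, hr⟩, ⟨i % Function.minimalPeriod σ r,
      Nat.mod_lt _ (minimalPeriod_perm_pos σ r)⟩⟩, ?_⟩
    simp only
    rw [← hi, ← Equiv.Perm.iterate_eq_pow, Function.iterate_mod_minimalPeriod_eq,
      Equiv.Perm.iterate_eq_pow]

lemma prod_trace_cycleProd [Fintype α] [DecidableEq α] {d : ℕ} (F : α → Matrix (Fin d) (Fin d) ℂ) {R : Finset α}
    (hR : ∀ x, ∃! r, r ∈ R ∧ σ.SameCycle r x) :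
    ∏ f ∈ R, (cycleProd σ F f).trace = ∑ p : α → Fin d, ∏ x, F x (p x) (p (σ x)) := by
  let e := Equiv.ofBijective _ (bijective_pow_apply σ hR)
  have he : ∀ s, e ⟨s.1, finRotate _ s.2⟩ = σ (e s) := fun s =>
    pow_finRotate_apply σ (pow_minimalPeriod_apply σ _) s.2
  let E : (α → Fin d) ≃ (Π f : R, Fin (Function.minimalPeriod σ (f : α)) → Fin d) :=
    (Equiv.arrowCongr e.symm (Equiv.refl _)).trans
      (Equiv.piCurry fun (f : R) (_ : Fin (Function.minimalPeriod σ (f : α))) => Fin d)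
  calc ∏ f ∈ R, (cycleProd σ F f).trace
      = ∏ f : R, ∑ q : Fin (Function.minimalPeriod σ (f : α)) → Fin d,
          ∏ t : Fin (Function.minimalPeriod σ (f : α)), F ((σ ^ (t : ℕ)) f) (q t) (q (finRotate _ t)) := by
        rw [← Finset.prod_coe_sort]
        exact Finset.prod_congr rfl fun f _ =>
          trace_list_prod_eq_sum (minimalPeriod_perm_pos σ _) fun t => F ((σ ^ t) (f : α))
    _ = ∑ P : (Π f : R, Fin (Function.minimalPeriod σ (f : α)) → Fin d),
          ∏ f : R, ∏ t : Fin (Function.minimalPeriod σ (f : α)), F ((σ ^ (t : ℕ)) f)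
             (P f t) (P f (finRotate _ t)) := by
        rw [Finset.prod_univ_sum, Fintype.piFinset_univ]
    _ = _ := by
        rw [← E.sum_comp]
        refine Finset.sum_congr rfl fun p _ => ?_
        rw [← e.prod_comp, Fintype.prod_sigma]
        refine Finset.prod_congr rfl fun f _ => Finset.prod_congr rfl fun t _ => ?_
        rw [← he]
        rfl

end Cycles

/-! ### Integration over the edges of the ribbon graph -/

lemma existsUnique_mem_singleton_sameCycle {α : Type*} [Fintype α] [DecidableEq α]
    {σ : Equiv.Perm α} (hσ : σ.IsCycle) (hsupp : σ.support = Finset.univ) (x₀ x : α) :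
    ∃! r, r ∈ ({x₀} : Finset α) ∧ σ.SameCycle r x := by
  have hne : ∀ y, σ y ≠ y := fun y => Equiv.Perm.mem_support.mp (hsupp ▸ Finset.mem_univ y)
  exact ⟨x₀, ⟨by simp, hσ.sameCycle (hne _) (hne _)⟩, fun y hy => by simpa using hy.1⟩

lemma integral_prod_edges {G : Type*} [Group G] [TopologicalSpace G]
    [IsTopologicalGroup G] [CompactSpace G] [MeasurableSpace G] [BorelSpace G] (μ : Measure G)
    [μ.IsHaarMeasure] [IsProbabilityMeasure μ] {d : ℕ} [NeZero d]
    {ψ : G →* Matrix (Fin d) (Fin d) ℂ} (hψ : ∀ p q, Continuous fun g => ψ g p q)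
    (hirr : ∀ M, (∀ g, Commute (ψ g) M) → ∃ c : ℂ, M = c • 1) {n : ℕ}
    (p q : Fin n × Bool → Fin d) :
    Integrable (fun X : Fin n → G => ∏ s : Fin n × Bool,
      (if s.2 then ψ (X s.1) else ψ (X s.1)⁻¹) (p s) (q s)) (Measure.pi fun _ => μ) ∧
    ∫ X : Fin n → G, ∏ s : Fin n × Bool, (if s.2 then ψ (X s.1) else ψ (X s.1)⁻¹) (p s) (q s)
      ∂(Measure.pi fun _ => μ) = if p = q ∘ tauPerm n then ((d : ℂ)⁻¹) ^ n else 0 := by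
  have hsplit : (fun X : Fin n → G => ∏ s : Fin n × Bool,
      (if s.2 then ψ (X s.1) else ψ (X s.1)⁻¹) (p s) (q s)) = fun X => ∏ i,
        (fun i g => ψ g (p (i, true)) (q (i, true)) * ψ g⁻¹ (p (i, false)) (q (i, false)))
          i (X i) := by
    funext X
    simp [Fintype.prod_prod_type]
  rw [hsplit]
  refine ⟨Integrable.fintype_prod fun i => integrable_apply_mul_apply_inv μ hψ _ _ _ _, ?_⟩
  rw [integral_fintype_prod_eq_prod
    (fun (i : Fin n) (g : G) =>
      ψ g (p (i, true)) (q (i, true)) * ψ g⁻¹ (p (i, false)) (q (i, false)))]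
  simp only [integral_apply_mul_apply_inv μ hψ hirr]
  rw [Finset.prod_ite_zero]
  simp only [Finset.prod_const, Finset.card_univ, Fintype.card_fin, Finset.mem_univ, true_imp_iff]
  congr 1
  simp only [funext_iff, Prod.forall, Bool.forall_bool, Function.comp_apply, eq_iff_iff]
  exact forall_congr' fun i => ⟨fun h => ⟨h.2.symm, h.1⟩, fun h => ⟨h.2, h.1.symm⟩⟩

lemma integral_trace_cycleProd {G : Type*} [Group G] [TopologicalSpace G]
    [IsTopologicalGroup G] [CompactSpace G] [MeasurableSpace G] [BorelSpace G] (μ : Measure G)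
    [μ.IsHaarMeasure] [IsProbabilityMeasure μ] {d : ℕ} [NeZero d]
    {ψ : G →* Matrix (Fin d) (Fin d) ℂ} (hψ : ∀ p q, Continuous fun g => ψ g p q)
    (hirr : ∀ M, (∀ g, Commute (ψ g) M) → ∃ c : ℂ, M = c • 1) {n : ℕ}
    {σ : Equiv.Perm (Fin n × Bool)} (hσ : σ.IsCycle) (hsupp : σ.support = Finset.univ)
    (x₀ : Fin n × Bool) (D : Fin n × Bool → Matrix (Fin d) (Fin d) ℂ)
    {R : Finset (Fin n × Bool)} (hR : ∀ x, ∃! r, r ∈ R ∧ (tauPerm n * σ).SameCycle r x) :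
    ∫ X : Fin n → G, (cycleProd σ
        (fun s => (if s.2 then ψ (X s.1) else ψ (X s.1)⁻¹) * D s) x₀).trace
        ∂(Measure.pi fun _ => μ) =
      (d : ℂ)⁻¹ ^ n * ∏ f ∈ R, (cycleProd (tauPerm n * σ) D f).trace := by
  have hexp : ∀ X : Fin n → G, (cycleProd σ
      (fun s => (if s.2 then ψ (X s.1) else ψ (X s.1)⁻¹) * D s) x₀).trace =
      ∑ p : Fin n × Bool → Fin d, ∑ q : Fin n × Bool → Fin d,
        (∏ s : Fin n × Bool, (if s.2 then ψ (X s.1) else ψ (X s.1)⁻¹) (p s) (q s)) *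
          ∏ s, D s (q s) (p (σ s)) := by
    intro X
    have h := prod_trace_cycleProd σ
      (fun s => (if s.2 then ψ (X s.1) else ψ (X s.1)⁻¹) * D s)
      (existsUnique_mem_singleton_sameCycle hσ hsupp x₀)
    rw [Finset.prod_singleton] at h
    rw [h]
    refine Finset.sum_congr rfl fun p _ => ?_
    simp only [Matrix.mul_apply]
    rw [Finset.prod_univ_sum, Fintype.piFinset_univ]
    exact Finset.sum_congr rfl fun q _ => Finset.prod_mul_distrib
  have hedge := fun p q => integral_prod_edges μ hψ hirr (n := n) p q
  simp only [hexp]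
  rw [integral_finsetSum _ fun p _ => integrable_finsetSum _ fun q _ =>
    (hedge p q).1.mul_const _]
  have : ∀ p, ∫ X : Fin n → G, ∑ q : Fin n × Bool → Fin d,
        (∏ s : Fin n × Bool, (if s.2 then ψ (X s.1) else ψ (X s.1)⁻¹) (p s) (q s)) *
          ∏ s, D s (q s) (p (σ s)) ∂(Measure.pi fun _ => μ) =
      ∑ q : Fin n × Bool → Fin d, (if p = q ∘ tauPerm n then ((d : ℂ)⁻¹) ^ n else 0) *
          ∏ s, D s (q s) (p (σ s)) := fun p => by
    rw [integral_finsetSum _ fun q _ => (hedge p q).1.mul_const _]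
    exact Finset.sum_congr rfl fun q _ => by rw [integral_mul_const, (hedge p q).2]
  rw [Finset.sum_congr rfl fun p _ => this p, Finset.sum_comm, prod_trace_cycleProd _ D hR,
    Finset.mul_sum]
  refine Finset.sum_congr rfl fun q _ => ?_
  rw [Finset.sum_eq_single (q ∘ tauPerm n), if_pos rfl]
  · rfl
  · intro p _ hp
    rw [if_neg hp, zero_mul]
  · simp

lemma map_cycleProd {α R S F : Type*} [Monoid R] [Monoid S] [FunLike F R S] [MonoidHomClass F R S]
    (Φ : F) (σ : Equiv.Perm α) (f : α → R) (x : α) :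
    Φ (cycleProd σ f x) = cycleProd σ (fun y => Φ (f y)) x := by
  rw [cycleProd, map_list_prod, List.map_map]
  rfl

/-- The integral of the Schur polynomial of the dressed monodromy over a compact group that
covers the unitary group up to scalars. -/
theorem integral_schur_cycleProd_dress {G : Type*} [Group G] [TopologicalSpace G]
    [IsTopologicalGroup G] [CompactSpace G] [MeasurableSpace G] [BorelSpace G] (μ : Measure G)
    [μ.IsHaarMeasure] [IsProbabilityMeasure μ] {N n : ℕ} (j : G →* UN N) (hj : Continuous j)
    (hscalar : ∀ U : UN N, ∃ (z : ℂ) (g : G),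
      (U : Matrix (Fin N) (Fin N) ℂ) = z • (j g : Matrix (Fin N) (Fin N) ℂ))
    {σ : Equiv.Perm (Fin n × Bool)} (hσ : σ.IsCycle) (hsupp : σ.support = Finset.univ)
    (x₀ : Fin n × Bool) (C : Fin n × Bool → Matrix (Fin N) (Fin N) ℂ)
    {l : Fin N → ℕ} (hl : Antitone l)
    {R : Finset (Fin n × Bool)} (hR : ∀ x, ∃! r, r ∈ R ∧ (tauPerm n * σ).SameCycle r x) :
    ∫ X : Fin n → G, schur l (cycleProd σ
        (dress C fun i => (j (X i) : Matrix (Fin N) (Fin N) ℂ)) x₀) ∂(Measure.pi fun _ => μ) =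
      (schur l (1 : Matrix (Fin N) (Fin N) ℂ)) ^ (-(n : ℤ)) *
        ∏ f ∈ R, schur l (cycleProd (tauPerm n * σ) C f) := by
  obtain ⟨d, _, ρ, hρ, htr⟩ := exists_surjective_trace_eq_schur hl
  let Φ : Matrix (Fin N) (Fin N) ℂ →* Matrix (Fin d) (Fin d) ℂ :=
    (ρ : symTensor N (∑ i, l i) →* Matrix (Fin d) (Fin d) ℂ).comp (symPow _)
  have hΦ : ∀ A, schur l A = (Φ A).trace := fun A => (htr A).symm
  let ψ : G →* Matrix (Fin d) (Fin d) ℂ := Φ.comp ((Submonoid.subtype _).comp j)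
  have hψ : ∀ p q, Continuous fun g => ψ g p q := fun p q =>
    (continuous_map_symPow ρ p q).comp (continuous_subtype_val.comp hj)
  have hirr : ∀ M, (∀ g, Commute (ψ g) M) → ∃ c : ℂ, M = c • 1 := fun M hM =>
    exists_eq_smul_one_of_commute_symPow hρ fun U => by
      obtain ⟨z, g, hU⟩ := hscalar U
      have : symPow (∑ i, l i) (U : Matrix (Fin N) (Fin N) ℂ) =
          z ^ (∑ i, l i) • symPow (∑ i, l i) (j g : Matrix (Fin N) (Fin N) ℂ) :=
        Subtype.ext (by rw [hU]; exact tensorPow_smul z _)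
      rw [this, map_smul]
      exact (hM g).smul_left _
  have hone : schur l (1 : Matrix (Fin N) (Fin N) ℂ) = d := by simp [hΦ]
  have hdress : ∀ X : Fin n → G, schur l (cycleProd σ
      (dress C fun i => (j (X i) : Matrix (Fin N) (Fin N) ℂ)) x₀) =
      (cycleProd σ (fun s => (if s.2 then ψ (X s.1) else ψ (X s.1)⁻¹) * Φ (C s)) x₀).trace := by
    intro X
    rw [hΦ, map_cycleProd]
    congr 2
    funext s
    rw [dress, map_mul]
    congr 1
    split_ifs
    · rfl
    · change _ = Φ (j (X s.1)⁻¹ : Matrix (Fin N) (Fin N) ℂ)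
      rw [map_inv]
      rfl
  simp only [hdress]
  rw [integral_trace_cycleProd μ hψ hirr hσ hsupp x₀ _ hR, hone, _root_.zpow_neg, zpow_natCast, inv_pow]
  simp only [hΦ, map_cycleProd]

/-- For a ribbon graph with a single vertex (`σ` a single `2n`-cycle),
the `SU(N)^n` and `U(N)^n` Haar integrals of `s_λ(𝔙(X))` coincide and both equal
`s_λ(I_N)^{-n} · ∏_f s_λ(𝔙*_f)`. -/
theorem statement3 {N n : ℕ} (hN : 1 ≤ N) (hn : 0 < n)
    (σ : Equiv.Perm (Fin n × Bool))
    (hcyc : σ.IsCycle) (hsupp : σ.support = Finset.univ)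
    (C : Fin n × Bool → Matrix (Fin N) (Fin N) ℂ)
    (l : Fin N → ℕ) (hl : Antitone l)
    (Rf : Finset (Fin n × Bool))
    (hRf : ∀ x, ∃! r, r ∈ Rf ∧ (tauPerm n * σ).SameCycle r x)
    (μU : Measure (UN N)) [μU.IsHaarMeasure] [IsProbabilityMeasure μU]
    (μSU : Measure (SUN N)) [μSU.IsHaarMeasure] [IsProbabilityMeasure μSU] :
    (∫ X : Fin n → SUN N,
        schur l (cycleProd σ
          (dress C fun i => (((X i : UN N) : Matrix (Fin N) (Fin N) ℂ))) (⟨0, hn⟩, true))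
        ∂(Measure.pi fun _ : Fin n => μSU)) =
      (∫ X : Fin n → UN N,
        schur l (cycleProd σ
          (dress C fun i => ((X i : Matrix (Fin N) (Fin N) ℂ))) (⟨0, hn⟩, true))
        ∂(Measure.pi fun _ : Fin n => μU)) ∧
    (∫ X : Fin n → UN N,
        schur l (cycleProd σ
          (dress C fun i => ((X i : Matrix (Fin N) (Fin N) ℂ))) (⟨0, hn⟩, true))
        ∂(Measure.pi fun _ : Fin n => μU)) =
      (schur l (1 : Matrix (Fin N) (Fin N) ℂ)) ^ (-(n : ℤ)) *
        ∏ f ∈ Rf, schur l (cycleProd (tauPerm n * σ) C f) := by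
  have hSU := integral_schur_cycleProd_dress μSU (SUN N).subtype continuous_subtype_val
    (exists_eq_smul_of_mem_SUN hN) hcyc hsupp (⟨0, hn⟩, true) C hl hRf
  have hU := integral_schur_cycleProd_dress μU (MonoidHom.id (UN N)) continuous_id
    (fun U => ⟨1, U, (one_smul _ _).symm⟩) hcyc hsupp (⟨0, hn⟩, true) C hl hRf
  exact ⟨hSU.trans hU.symm, hU⟩

end
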